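/- arXiv:2211.07822 — 2 statements merged into one kernel-verified Lean document; each statement's English description precedes it below -/
import Mathlib

section
/- Let n, k, a, r be integers with r ≥ 2, 0 ≤ a ≤ ⌊(k-1)/2⌋ and n ≥ k. Then the graph H(n,k,a) is 𝓛_k-free and the number of r-cliques of H(n,k,a) equals h_r(n,k,a). -/
open SimpleGraph

/-- The degree of a vertex `v` in a graph `G` (as the cardinality of its neighbor set). -/
noncomputable def degN {V : Type*} (G : SimpleGraph V) (v : V) : ℕ :=
  (G.neighborSet v).ncard

/-- A linear forest: an acyclic graph all of whose vertices have degree at most `2`,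
i.e. a forest whose connected components are paths and isolated vertices. -/
def IsLinearForest {V : Type*} (H : SimpleGraph V) : Prop :=
  H.IsAcyclic ∧ ∀ v, degN H v ≤ 2

/-- `G` is `𝓛ₖ`-free: it contains no linear forest with exactly `k` edges as a subgraph. -/
def LinearForestFree {V : Type*} (k : ℕ) (G : SimpleGraph V) : Prop :=
  ∀ H : SimpleGraph V, H ≤ G → IsLinearForest H → H.edgeSet.ncard ≠ k

/-- `Nr r G` is the number of `r`-cliques of `G`. -/
noncomputable def Nr {V : Type*} (r : ℕ) (G : SimpleGraph V) : ℕ :=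
  {s : Finset V | G.IsNClique r s}.ncard

/-- `hr r n k a = C(k-a, r) + (n-k+a) * C(a, r-1)` (as an integer). -/
def hr (r n k a : ℕ) : ℤ :=
  (Nat.choose (k - a) r : ℤ) + ((n : ℤ) - (k : ℤ) + (a : ℤ)) * (Nat.choose a (r - 1) : ℤ)

/-- The graph `H(n,k,a)`: vertices `0,…,a-1` form the set `A`, vertices `a,…,k-a-1` form
the set `B`, the remaining `n-k+a` vertices form the set `C`; the edges are all edges inside
`A ∪ B` together with all edges between `A` and `C`. -/
def HGraph (n k a : ℕ) : SimpleGraph (Fin n) :=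
  SimpleGraph.fromRel (fun u v => (u : ℕ) < a ∨ ((u : ℕ) < k - a ∧ (v : ℕ) < k - a))

/-- `H⁺(n,k,a)`: the graph `H(n,k,a)` with one extra edge inside `C`
(between the first two vertices of `C`). -/
def HplusGraph (n k a : ℕ) : SimpleGraph (Fin n) :=
  SimpleGraph.fromRel (fun u v => (u : ℕ) < a ∨ ((u : ℕ) < k - a ∧ (v : ℕ) < k - a)
    ∨ ((u : ℕ) = k - a ∧ (v : ℕ) = k - a + 1))

/-- `H⁺⁺(n,k,a)`: the graph `H(n,k,a)` with two extra independent edges inside `C`. -/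
def HplusplusGraph (n k a : ℕ) : SimpleGraph (Fin n) :=
  SimpleGraph.fromRel (fun u v => (u : ℕ) < a ∨ ((u : ℕ) < k - a ∧ (v : ℕ) < k - a)
    ∨ ((u : ℕ) = k - a ∧ (v : ℕ) = k - a + 1)
    ∨ ((u : ℕ) = k - a + 2 ∧ (v : ℕ) = k - a + 3))

/-- `G` is isomorphic to a subgraph of `H`. -/
def IsoSubgraph {V W : Type*} (G : SimpleGraph V) (H : SimpleGraph W) : Prop :=
  ∃ f : V ↪ W, ∀ u v, G.Adj u v → H.Adj (f u) (f v)

theorem SimpleGraph.IsAcyclic.ncard_edgeSet_lt {V : Type*} [Finite V] [Nonempty V]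
    {H : SimpleGraph V} (hH : H.IsAcyclic) : H.edgeSet.ncard < Nat.card V := by
  classical
  obtain ⟨T, hHT, -, hT⟩ :=
    (connected_top (V := V)).exists_isTree_le_of_le_of_isAcyclic le_top hH
  have hcard := (isTree_iff_connected_and_card.mp hT).2
  have hle : H.edgeSet.ncard ≤ T.edgeSet.ncard :=
    Set.ncard_le_ncard (edgeSet_mono hHT) (Set.toFinite _)
  rw [Nat.card_coe_set_eq] at hcard
  omega

theorem ncard_incidenceSet {V : Type*} (G : SimpleGraph V) (v : V) :
    (G.incidenceSet v).ncard = degN G v := by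
  classical
  exact Nat.card_congr (G.incidenceSetEquivNeighborSet v)

/-- If every edge of a linear forest meets `A` or lies inside the nonempty set `B`, then there are
fewer than `2 * |A| + |B|` edges. -/
theorem IsLinearForest.ncard_edgeSet_lt {V : Type*} [Finite V] {H : SimpleGraph V}
    (hH : IsLinearForest H) (A : Finset V) (B : Set V) (hB : B.Nonempty)
    (hcover : ∀ u v, H.Adj u v → u ∈ A ∨ v ∈ A ∨ (u ∈ B ∧ v ∈ B)) :
    H.edgeSet.ncard < 2 * A.card + B.ncard := by
  have := hB.to_subtype
  have hsub : H.edgeSet ⊆ (⋃ v ∈ A, H.incidenceSet v) ∪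
      Sym2.map Subtype.val '' (H.induce B).edgeSet := by
    intro e
    induction e using Sym2.ind with
    | _ u v =>
      intro he
      rcases hcover u v he with h | h | ⟨hu, hv⟩
      · exact Or.inl (Set.mem_biUnion h ⟨he, Sym2.mem_mk_left u v⟩)
      · exact Or.inl (Set.mem_biUnion h ⟨he, Sym2.mem_mk_right u v⟩)
      · exact Or.inr ⟨s(⟨u, hu⟩, ⟨v, hv⟩), he, rfl⟩
  have hA : (⋃ v ∈ A, H.incidenceSet v).ncard ≤ 2 * A.card := by
    refine (A.set_ncard_biUnion_le _).trans ?_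
    rw [mul_comm]
    exact Finset.sum_le_card_nsmul _ _ _ fun v _ => (ncard_incidenceSet H v).trans_le (hH.2 v)
  have hBlt := (hH.1.induce B).ncard_edgeSet_lt
  rw [Nat.card_coe_set_eq] at hBlt
  calc H.edgeSet.ncard
      ≤ _ := Set.ncard_le_ncard hsub (Set.toFinite _)
    _ ≤ _ := Set.ncard_union_le _ _
    _ < 2 * A.card + B.ncard :=
      add_lt_add_of_le_of_lt hA ((Set.ncard_image_le (Set.toFinite _)).trans_lt hBlt)

theorem HGraph_adj {n k a : ℕ} {u v : Fin n} :
    (HGraph n k a).Adj u v ↔ u ≠ v ∧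
      ((u : ℕ) < a ∨ (v : ℕ) < a ∨ ((u : ℕ) < k - a ∧ (v : ℕ) < k - a)) := by
  simp only [HGraph, fromRel_adj]
  tauto

theorem card_filter_val_lt {n m : ℕ} (h : m ≤ n) :
    (Finset.univ.filter fun v : Fin n => (v : ℕ) < m).card = m := by
  simp [Fin.card_filter_val_lt, h]

theorem linearForestFree_HGraph {n k a : ℕ} (hak : 2 * a < k) (hn : k ≤ n) :
    LinearForestFree k (HGraph n k a) := by
  intro H hle hH
  set A : Finset (Fin n) := Finset.univ.filter fun v => (v : ℕ) < a
  set AB : Finset (Fin n) := Finset.univ.filter fun v => (v : ℕ) < k - a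
  have hcA : A.card = a := card_filter_val_lt (by omega)
  have hcAB : AB.card = k - a := card_filter_val_lt (by omega)
  have hAB : A ⊆ AB := by
    intro v
    simp only [A, AB, Finset.mem_filter, Finset.mem_univ, true_and]
    omega
  have hcB : (AB \ A).card = k - 2 * a := by
    rw [Finset.card_sdiff_of_subset hAB]
    omega
  have hlt := hH.ncard_edgeSet_lt A (AB \ A : Finset (Fin n))
    (Finset.coe_nonempty.mpr (Finset.card_pos.mp (by omega))) fun u v huv => by
      have := (HGraph_adj.mp (hle huv)).2
      simp only [A, AB, Finset.coe_sdiff, Set.mem_sdiff, Finset.mem_coe, Finset.mem_filter,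
        Finset.mem_univ, true_and]
      omega
  rw [Set.ncard_coe_finset] at hlt
  omega

/-- A clique of `H(n,k,a)` either avoids `C`, or is a vertex of `C` added to a subset of `A`. -/
theorem isNClique_HGraph_iff {n k a r : ℕ} (hak : a ≤ k - a) (hr : 1 ≤ r) (s : Finset (Fin n)) :
    (HGraph n k a).IsNClique r s ↔
      ((∀ v ∈ s, (v : ℕ) < k - a) ∧ s.card = r) ∨
      ∃ c : Fin n, k - a ≤ (c : ℕ) ∧
        ∃ t : Finset (Fin n), ((∀ v ∈ t, (v : ℕ) < a) ∧ t.card = r - 1) ∧ insert c t = s := by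
  rw [isNClique_iff]
  constructor
  · rintro ⟨hs, hcard⟩
    by_cases h : ∀ v ∈ s, (v : ℕ) < k - a
    · exact Or.inl ⟨h, hcard⟩
    · push Not at h
      obtain ⟨c, hcs, hc⟩ := h
      refine Or.inr ⟨c, hc, s.erase c, ⟨fun v hv => ?_, ?_⟩, Finset.insert_erase hcs⟩
      · have hv' := Finset.mem_erase.mp hv
        have := (HGraph_adj.mp (hs hv'.2 hcs hv'.1)).2
        omega
      · rw [Finset.card_erase_of_mem hcs, hcard]
  · rintro (⟨h, hcard⟩ | ⟨c, hc, t, ⟨ht, hcard⟩, rfl⟩)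
    · exact ⟨fun u hu v hv huv => HGraph_adj.mpr ⟨huv, Or.inr (Or.inr ⟨h u hu, h v hv⟩)⟩, hcard⟩
    · refine ⟨fun u hu v hv huv => HGraph_adj.mpr ⟨huv, ?_⟩, ?_⟩
      · rcases Finset.mem_insert.mp (Finset.mem_coe.mp hu) with rfl | hu
        · rcases Finset.mem_insert.mp (Finset.mem_coe.mp hv) with rfl | hv
          · exact absurd rfl huv
          · exact Or.inr (Or.inl (ht v hv))
        · exact Or.inl (ht u hu)
      · rw [Finset.card_insert_of_notMem fun hct => by have := ht c hct; omega]
        omega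

theorem Nr_HGraph {n k a r : ℕ} (hak : a ≤ k - a) (hr : 1 ≤ r) (hn : k ≤ n) :
    Nr r (HGraph n k a) = (k - a).choose r + (n - (k - a)) * a.choose (r - 1) := by
  set A : Finset (Fin n) := Finset.univ.filter fun v => (v : ℕ) < a with hA
  set AB : Finset (Fin n) := Finset.univ.filter fun v => (v : ℕ) < k - a with hAB
  have hcA : A.card = a := card_filter_val_lt (by omega)
  have hcAB : AB.card = k - a := card_filter_val_lt (by omega)
  have hmem (v : Fin n) : v ∈ A ↔ (v : ℕ) < a := by simp [hA]
  have hmem' (v : Fin n) : v ∈ AB ↔ (v : ℕ) < k - a := by simp [hAB]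
  set S := (ABᶜ ×ˢ A.powersetCard (r - 1)).image fun p => insert p.1 p.2 with hS
  have hcliques : {s | (HGraph n k a).IsNClique r s} = ↑(AB.powersetCard r ∪ S) := by
    ext s
    simp [isNClique_HGraph_iff hak hr, hS, Finset.subset_iff, hmem, hmem']
  have hdisj : Disjoint (AB.powersetCard r) S := by
    refine Finset.disjoint_left.mpr fun s hs hs' => ?_
    obtain ⟨⟨c, t⟩, hp, rfl⟩ := Finset.mem_image.mp hs'
    exact Finset.mem_compl.mp (Finset.mem_product.mp hp).1
      ((Finset.mem_powersetCard.mp hs).1 (Finset.mem_insert_self c t))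
  have hinj : Set.InjOn (fun p : Fin n × Finset (Fin n) => insert p.1 p.2)
      ↑(ABᶜ ×ˢ A.powersetCard (r - 1)) := by
    rintro ⟨c, t⟩ hp ⟨d, u⟩ hq h
    simp only [Finset.coe_product, Set.mem_prod, Finset.mem_coe, Finset.mem_compl, hmem',
      Finset.mem_powersetCard, Finset.subset_iff, hmem] at hp hq
    change insert c t = insert d u at h
    have hct : c ∉ t := fun hc => by have := hp.2.1 hc; omega
    have hcu : c ∉ u := fun hc => by have := hq.2.1 hc; omega
    have hcd : c = d := (Finset.mem_insert.mp (h ▸ Finset.mem_insert_self c t)).resolve_right hcu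
    subst hcd
    rw [← Finset.erase_insert hct, ← Finset.erase_insert hcu]
    exact congrArg (fun s => (c, s.erase c)) h
  rw [Nr, hcliques, Set.ncard_coe_finset, Finset.card_union_of_disjoint hdisj,
    Finset.card_image_of_injOn hinj, Finset.card_product, Finset.card_powersetCard,
    Finset.card_powersetCard, Finset.card_compl, Fintype.card_fin, hcA, hcAB]

/-- For `r ≥ 2`, `0 ≤ a ≤ ⌊(k-1)/2⌋` and `n ≥ k`, the graph `H(n,k,a)` is
`𝓛ₖ`-free and its number of `r`-cliques equals `hᵣ(n,k,a)`. -/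
theorem statement3 (n k a r : ℕ) (hk : 1 ≤ k) (hr2 : 2 ≤ r)
    (ha : a ≤ (k - 1) / 2) (hn : k ≤ n) :
    LinearForestFree k (HGraph n k a) ∧ (Nr r (HGraph n k a) : ℤ) = hr r n k a := by
  refine ⟨linearForestFree_HGraph (by omega) hn, ?_⟩
  rw [Nr_HGraph (by omega) (by omega) hn, hr]
  have : ((n - (k - a) : ℕ) : ℤ) = n - k + a := by omega
  push_cast [this]
  rfl
end

section
/- Let k be an odd positive integer and let G be an 𝓛_k-free graph on n vertices with minimum degree at least d. If n > k^5, 2 ≤ r ≤ ⌊(k-3)/2⌋ and N_r(G) > max{ h_r(n,k,d), h_r(n,k,⌊(k-5)/2⌋) }, then G is isomorphic to a subgraph of H(n, k, ⌊(k-1)/2⌋), of H(n, k, ⌊(k-3)/2⌋), or of H^+(n, k-1, ⌊(k-3)/2⌋). -/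
open SimpleGraph

section AdjacentPairs

open Classical Finset

/-- The indicator of adjacency. -/
noncomputable def adjInd {V : Type*} (G : SimpleGraph V) (x y : V) : ℕ :=
  if G.Adj x y then 1 else 0

/-- The number of consecutive entries of a list that are adjacent in `G`. -/
noncomputable def adjCount {V : Type*} (G : SimpleGraph V) : List V → ℕ
  | [] => 0
  | [_] => 0
  | x :: y :: l => adjInd G x y + adjCount G (y :: l)

/-- The adjacency indicator of two optional vertices, `0` if one of them is missing. -/
noncomputable def adjLink {V : Type*} (G : SimpleGraph V) : Option V → Option V → ℕ
  | some x, some y => adjInd G x y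
  | _, _ => 0

variable {V : Type*} {G : SimpleGraph V}

lemma adjInd_of_adj {x y : V} (h : G.Adj x y) : adjInd G x y = 1 := if_pos h

lemma adjInd_of_not_adj {x y : V} (h : ¬ G.Adj x y) : adjInd G x y = 0 := if_neg h

@[simp] lemma adjInd_self (x : V) : adjInd G x x = 0 := by simp [adjInd]

lemma adjInd_le_one (x y : V) : adjInd G x y ≤ 1 := by
  unfold adjInd; split_ifs <;> simp

lemma adjInd_comm (x y : V) : adjInd G x y = adjInd G y x := by
  simp [adjInd, G.adj_comm]

@[simp] lemma adjCount_nil : adjCount G [] = 0 := by simp [adjCount]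

@[simp] lemma adjCount_singleton (x : V) : adjCount G [x] = 0 := by simp [adjCount]

@[simp] lemma adjCount_cons_cons (x y : V) (l : List V) :
    adjCount G (x :: y :: l) = adjInd G x y + adjCount G (y :: l) := by
  simp [adjCount]

@[simp] lemma adjLink_some (x y : V) : adjLink G (some x) (some y) = adjInd G x y := rfl

@[simp] lemma adjLink_none_left (o : Option V) : adjLink G none o = 0 := rfl

@[simp] lemma adjLink_none_right (o : Option V) : adjLink G o none = 0 := by
  cases o <;> rfl

lemma adjLink_comm (o o' : Option V) : adjLink G o o' = adjLink G o' o := by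
  cases o <;> cases o' <;> simp [adjInd_comm]

lemma adjCount_cons (x : V) (l : List V) :
    adjCount G (x :: l) = adjLink G (some x) l.head? + adjCount G l := by
  cases l <;> simp

lemma adjCount_append (l₁ l₂ : List V) :
    adjCount G (l₁ ++ l₂) =
      adjCount G l₁ + adjLink G l₁.getLast? l₂.head? + adjCount G l₂ := by
  induction l₁ with
  | nil => simp
  | cons x l ih =>
    cases l with
    | nil => simp [adjCount_cons]
    | cons y l => simp at ih ⊢; omega

lemma add_adjCount_le_append (l₁ l₂ : List V) :
    adjCount G l₁ + adjCount G l₂ ≤ adjCount G (l₁ ++ l₂) := by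
  rw [adjCount_append]; omega

lemma adjCount_reverse (l : List V) : adjCount G l.reverse = adjCount G l := by
  induction l with
  | nil => simp
  | cons x l ih =>
    rw [List.reverse_cons, adjCount_append, adjCount_cons x l, ih, List.getLast?_reverse,
      adjLink_comm (some x)]
    simp
    omega

/-- A long list with few adjacent pairs has a nonadjacent pair of consecutive entries. -/
lemma exists_not_adj_split (l : List V) (hl : adjCount G l + 1 < l.length) :
    ∃ p x y q, l = p ++ x :: y :: q ∧ ¬ G.Adj x y := by
  induction l with
  | nil => simp at hl
  | cons x l ih =>
    cases l with
    | nil => simp at hl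
    | cons y l =>
      by_cases h : G.Adj x y
      · rw [adjCount_cons_cons, adjInd_of_adj h] at hl
        obtain ⟨p, a, b, q, h₁, h₂⟩ := ih (by simp at *; omega)
        exact ⟨x :: p, a, b, q, by simp [h₁], h₂⟩
      · exact ⟨[], x, y, l, rfl, h⟩

/-- Every duplicate-free list extends to a duplicate-free enumeration of a given finite set. -/
lemma exists_append_nodup (T : Finset V) (l : List V) (hl : l.Nodup) (hT : ∀ x ∈ l, x ∈ T) :
    ∃ l', (l ++ l').Nodup ∧ (l ++ l').toFinset = T := by
  refine ⟨(T \ l.toFinset).toList, ?_, ?_⟩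
  · rw [List.nodup_append]
    refine ⟨hl, Finset.nodup_toList _, ?_⟩
    rintro a ha b hb rfl
    simp [ha] at hb
  · ext x
    have := hT x
    simp
    tauto

lemma sum_adjInd_le (u v : V) (l : List V)
    (h : ∀ p x y q, l = p ++ x :: y :: q → adjInd G u x + adjInd G v y ≤ adjInd G x y) :
    (l.map (adjInd G u)).sum + (l.map (adjInd G v)).sum ≤
      adjCount G l + adjLink G (some u) l.getLast? + adjLink G (some v) l.head? := by
  induction l with
  | nil => simp
  | cons x l ih =>
    cases l with
    | nil => simp
    | cons y l =>
      have h₁ := ih (fun p a b q hq => h (x :: p) a b q (by simp [hq]))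
      have h₂ := h [] x y l rfl
      simp at *
      omega

/-- Every duplicate-free list has fewer than `k` adjacent pairs of consecutive entries. -/
def PairBounded (k : ℕ) (G : SimpleGraph V) : Prop :=
  ∀ l : List V, l.Nodup → adjCount G l < k

lemma adjCount_sup_edge_of_notMem {u v : V} (l : List V) (h : u ∉ l ∨ v ∉ l) :
    adjCount (G ⊔ edge u v) l = adjCount G l := by
  induction l with
  | nil => simp
  | cons x l ih =>
    cases l with
    | nil => simp
    | cons y l =>
      have h₁ := ih (by simp at *; tauto)
      have h₂ : adjInd (G ⊔ edge u v) x y = adjInd G x y := by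
        have : (G ⊔ edge u v).Adj x y ↔ G.Adj x y := by
          simp [edge_adj] at *
          grind
        simp only [adjInd, this]
      simp [h₁, h₂]

lemma exists_split_of_adjCount_lt {u v : V} (l : List V)
    (h : adjCount G l < adjCount (G ⊔ edge u v) l) :
    (∃ p s, l = p ++ u :: v :: s) ∨ ∃ p s, l = p ++ v :: u :: s := by
  induction l with
  | nil => simp at h
  | cons x l ih =>
    cases l with
    | nil => simp at h
    | cons y l =>
      by_cases hxy : (G ⊔ edge u v).Adj x y ∧ ¬ G.Adj x y
      · have : (x = u ∧ y = v) ∨ (x = v ∧ y = u) := by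
          simp [edge_adj] at hxy
          grind
        rcases this with ⟨rfl, rfl⟩ | ⟨rfl, rfl⟩
        · exact Or.inl ⟨[], l, rfl⟩
        · exact Or.inr ⟨[], l, rfl⟩
      · have : adjInd (G ⊔ edge u v) x y = adjInd G x y := by
          have : (G ⊔ edge u v).Adj x y ↔ G.Adj x y :=
            ⟨fun h => by tauto, fun h => Or.inl h⟩
          simp only [adjInd, this]
        rcases ih (by simp at h ⊢; omega) with ⟨p, s, h⟩ | ⟨p, s, h⟩
        · exact Or.inl ⟨x :: p, s, by simp [h]⟩
        · exact Or.inr ⟨x :: p, s, by simp [h]⟩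

lemma le_adjCount_of_split {k : ℕ} {u v : V} (p s : List V) (hnd : (p ++ u :: v :: s).Nodup)
    (hk : k ≤ adjCount (G ⊔ edge u v) (p ++ u :: v :: s)) :
    k ≤ adjCount G (p ++ [u]) + adjCount G (v :: s) + 1 := by
  have hsplit : p ++ u :: v :: s = (p ++ [u]) ++ (v :: s) := by simp
  rw [hsplit, adjCount_append, adjCount_sup_edge_of_notMem, adjCount_sup_edge_of_notMem] at hk
  · have := adjInd_le_one (G := G ⊔ edge u v) u v
    simp at hk
    omega
  · left
    rw [List.nodup_append] at hnd
    simp at hnd ⊢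
    tauto
  · right
    rw [List.nodup_append] at hnd
    simp at hnd ⊢
    grind

section Closure

variable [Fintype V]

lemma sum_map_adjInd (l : List V) (hl : l.Nodup) (hT : l.toFinset = univ) (u : V) :
    (l.map (adjInd G u)).sum = #{x | G.Adj u x} := by
  rw [← List.sum_toFinset _ hl, hT, Finset.card_filter]
  rfl

lemma degree_add_degree_lt_of_split {k : ℕ} (hG : PairBounded k G) (p s : List V) (u v : V)
    (hnd : (p ++ u :: v :: s).Nodup) (hT : (p ++ u :: v :: s).toFinset = univ)
    (hk : k ≤ adjCount G (p ++ [u]) + adjCount G (v :: s) + 1) :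
    #{x | G.Adj u x} + #{x | G.Adj v x} < k := by
  have hsplit : p ++ u :: v :: s = (p ++ [u]) ++ (v :: s) := by simp
  rw [hsplit] at hnd hT
  set L := p ++ [u] with hL
  set R := v :: s with hR
  have hLl : L.getLast? = some u := by simp [hL]
  have hRh : R.head? = some v := by simp [hR]
  clear_value L R
  have e₁ := sum_map_adjInd (G := G) _ hnd hT u
  have e₂ := sum_map_adjInd (G := G) _ hnd hT v
  have b₁ := sum_adjInd_le (G := G) u v L (by
    intro p₁ x y q hq
    have hq' : L = (p₁ ++ [x]) ++ (y :: q) := by simp [hq]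
    have hlast : (y :: q).getLast? = some u := by
      rw [← hLl, hq']; simp [List.getLast?_append, List.getLast?_cons]
    have hperm : ((p₁ ++ [x]) ++ (y :: q).reverse ++ R).Perm (L ++ R) := by
      rw [hq']
      exact ((List.reverse_perm _).append_left _).append_right _
    have := hG _ (hperm.nodup_iff.2 hnd)
    rw [adjCount_append, adjCount_append, adjCount_reverse, List.head?_reverse, hlast, hRh]
      at this
    rw [hq', adjCount_append] at hk
    simp only [List.reverse_cons, List.getLast?_append, List.getLast?_singleton,
      Option.some_or, List.head?_cons, adjLink_some] at this hk
    rw [adjInd_comm x u, adjInd_comm y v] at this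
    omega)
  have b₂ := sum_adjInd_le (G := G) u v R (by
    intro p₁ x y q hq
    have hq' : R = (p₁ ++ [x]) ++ (y :: q) := by simp [hq]
    have hhead : (p₁ ++ [x]).head? = some v := by
      rw [← hRh, hq']; cases p₁ <;> simp
    have hperm : (L ++ ((p₁ ++ [x]).reverse ++ (y :: q))).Perm (L ++ R) := by
      rw [hq']
      exact ((List.reverse_perm _).append_right _).append_left _
    have := hG _ (hperm.nodup_iff.2 hnd)
    rw [adjCount_append, adjCount_append, adjCount_reverse, List.getLast?_reverse, hhead, hLl]
      at this
    rw [hq', adjCount_append] at hk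
    simp only [List.reverse_append, List.reverse_singleton,
      List.cons_append, List.getLast?_append, List.getLast?_singleton,
      Option.some_or, List.head?_cons, adjLink_some] at this hk
    omega)
  have c₁ := hG (L.reverse ++ R)
    ((((List.reverse_perm _).append_right _).nodup_iff).2 hnd)
  have c₂ := hG (L ++ R.reverse)
    ((((List.reverse_perm _).append_left _).nodup_iff).2 hnd)
  rw [adjCount_append, adjCount_reverse, List.getLast?_reverse, hRh, adjLink_comm] at c₁
  rw [adjCount_append, adjCount_reverse, List.head?_reverse, hLl] at c₂
  rw [hLl] at b₁
  rw [hRh] at b₂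
  rw [List.map_append, List.sum_append] at e₁ e₂
  simp only [adjLink_some, adjInd_self] at b₁ b₂
  omega

/-- In an edge-maximal graph, nonadjacent vertices have small degree sum. -/
lemma degree_add_degree_lt {k : ℕ} (hG : Maximal (PairBounded k) G) {u v : V} (huv : u ≠ v)
    (hadj : ¬ G.Adj u v) : #{x | G.Adj u x} + #{x | G.Adj v x} < k := by
  have hne : ¬ PairBounded k (G ⊔ edge u v) := fun h => by
    have := hG.2 h le_sup_left
    exact hadj (this (Or.inr ((edge_adj ..).2 ⟨Or.inl ⟨rfl, rfl⟩, huv⟩)))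
  unfold PairBounded at hne
  push Not at hne
  obtain ⟨l₀, hl₀, hk₀⟩ := hne
  obtain ⟨l', hnd, hT⟩ := exists_append_nodup univ l₀ hl₀ (by simp)
  have hk : k ≤ adjCount (G ⊔ edge u v) (l₀ ++ l') :=
    (hk₀.trans (Nat.le_add_right _ _)).trans (add_adjCount_le_append _ _)
  generalize l₀ ++ l' = l at *
  rcases exists_split_of_adjCount_lt l ((hG.1 l hnd).trans_le hk) with ⟨p, s, rfl⟩ | ⟨p, s, rfl⟩
  · exact degree_add_degree_lt_of_split hG.1 p s u v hnd hT (le_adjCount_of_split p s hnd hk)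
  · rw [add_comm]
    rw [edge_comm] at hk
    exact degree_add_degree_lt_of_split hG.1 p s v u hnd hT (le_adjCount_of_split p s hnd hk)

end Closure

lemma exists_linearForest [Finite V] (l : List V) (hl : l.Nodup) :
    ∃ H ≤ G, IsLinearForest H ∧ H.edgeSet.ncard = adjCount G l ∧
      (∀ x y, H.Adj x y → x ∈ l) ∧ ∀ x, l.head? = some x → degN H x ≤ 1 := by
  induction l with
  | nil => exact ⟨⊥, bot_le, ⟨isAcyclic_bot, by simp [degN]⟩, by simp, by simp, by simp⟩
  | cons x l ih =>
    obtain ⟨H, hHG, ⟨hac, hdeg⟩, hcard, hmem, hhead⟩ := ih hl.of_cons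
    have hx : x ∉ l := (List.nodup_cons.1 hl).1
    have hxH : ∀ z, ¬ H.Adj x z := fun z hz => hx (hmem x z hz)
    have hx0 : degN H x = 0 := by
      have : H.neighborSet x = ∅ := by ext z; simp [hxH]
      simp [degN, this]
    cases l with
    | nil =>
      exact ⟨H, hHG, ⟨hac, hdeg⟩, by simpa using hcard,
        fun a b h => List.mem_cons_of_mem _ (hmem a b h), by simp [hx0]⟩
    | cons y l =>
      have hxy : x ≠ y := by rintro rfl; simp at hx
      by_cases hadj : G.Adj x y
      · have hN : ∀ v, degN (H ⊔ edge x y) v ≤ degN H v + if v = x ∨ v = y then 1 else 0 := by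
          intro v
          by_cases hv : v = x ∨ v = y
          · have : (H ⊔ edge x y).neighborSet v ⊆
                H.neighborSet v ∪ {if v = x then y else x} := by
              intro z
              simp [edge_adj]
              grind
            refine (Set.ncard_le_ncard this (Set.toFinite _)).trans
              ((Set.ncard_union_le _ _).trans ?_)
            simp [hv, degN]
          · have : (H ⊔ edge x y).neighborSet v = H.neighborSet v := by
              ext z
              simp [edge_adj]
              grind
            simp [degN, this]
        refine ⟨H ⊔ edge x y, sup_le hHG ?_, ⟨?_, ?_⟩, ?_, ?_, ?_⟩
        · exact (edge_le_iff _).2 (Or.inr hadj)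
        · apply hac.sup_edge_of_not_reachable
          rintro ⟨w⟩
          cases w with
          | nil => exact hxy rfl
          | cons h _ => exact hxH _ h
        · intro v
          have h₁ := hN v
          have h₂ := hdeg v
          have h₃ := hhead y rfl
          split_ifs at h₁ with hv
          · rcases hv with rfl | rfl <;> omega
          · omega
        · rw [edgeSet_sup, edgeSet_edge_of_ne hxy, Set.union_singleton,
            Set.ncard_insert_of_notMem _ (Set.toFinite _), hcard, adjCount_cons_cons,
            adjInd_of_adj hadj, add_comm]
          exact hxH y
        · intro a b h
          simp [edge_adj] at h ⊢
          have := hmem a b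
          simp at this
          tauto
        · intro z hz
          simp at hz
          subst hz
          have := hN x
          simp [hx0] at this
          exact this
      · refine ⟨H, hHG, ⟨hac, hdeg⟩, by simpa [adjInd_of_not_adj hadj] using hcard,
          fun a b h => List.mem_cons_of_mem _ (hmem a b h), ?_⟩
        intro z hz
        simp at hz
        subst hz
        omega

lemma exists_nodup_adjCount_eq {k : ℕ} (l : List V) (hl : l.Nodup) (hk : k ≤ adjCount G l) :
    ∃ l' : List V, l'.Nodup ∧ adjCount G l' = k := by
  induction l with
  | nil => exact ⟨[], hl, by simp at hk; simp [hk]⟩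
  | cons x l ih =>
    by_cases h : k ≤ adjCount G l
    · exact ih hl.of_cons h
    · refine ⟨x :: l, hl, ?_⟩
      cases l with
      | nil => simp at h hk; omega
      | cons y l =>
        have := adjInd_le_one (G := G) x y
        simp at h hk ⊢
        omega

lemma PairBounded.of_linearForestFree [Finite V] {k : ℕ} (h : LinearForestFree k G) :
    PairBounded k G := by
  intro l hl
  by_contra! hk
  obtain ⟨l', hl', hk'⟩ := exists_nodup_adjCount_eq l hl hk
  obtain ⟨H, hH, hlf, hcard, -⟩ := exists_linearForest (G := G) l' hl'
  exact h H hH hlf (hcard.trans hk')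

end AdjacentPairs

section CliqueCount

open Classical Finset

variable {V : Type*} {G : SimpleGraph V}

/-- The number of `r`-cliques inside a finite vertex set. -/
noncomputable def cliqueCount (G : SimpleGraph V) (r : ℕ) (W : Finset V) : ℕ :=
  #((W.powersetCard r).filter fun s : Finset V => G.IsClique s)

lemma cliqueCount_le_choose (r : ℕ) (W : Finset V) : cliqueCount G r W ≤ (#W).choose r :=
  (card_filter_le _ _).trans_eq (card_powersetCard _ _)

lemma Nr_eq_cliqueCount [Fintype V] (r : ℕ) : Nr r G = cliqueCount G r univ := by
  rw [Nr, cliqueCount, ← Set.ncard_coe_finset]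
  congr 1
  ext s
  simp [isNClique_iff, and_comm]

lemma cliqueCount_le_erase {p m : ℕ} {W : Finset V} {v : V}
    (hm : #{x ∈ W | G.Adj v x} ≤ m) :
    cliqueCount G (p + 1) W ≤ cliqueCount G (p + 1) (W.erase v) + m.choose p := by
  set S := (W.powersetCard (p + 1)).filter (fun s : Finset V => G.IsClique s) with hS
  have h₁ : #{s ∈ S | v ∉ s} ≤ cliqueCount G (p + 1) (W.erase v) := by
    apply card_le_card
    intro s
    simp only [hS, mem_filter, mem_powersetCard, subset_erase]
    tauto
  have h₂ : #{s ∈ S | v ∈ s} ≤ m.choose p := by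
    refine (card_le_card_of_injOn (fun s => s.erase v)
      (t := ({x ∈ W | G.Adj v x} : Finset V).powersetCard p) ?_ ?_).trans ?_
    · intro s
      simp only [hS, coe_filter, mem_filter, mem_powersetCard, Set.mem_ofPred_eq, mem_coe]
      rintro ⟨⟨⟨hsW, hcard⟩, hcl⟩, hv⟩
      refine ⟨fun x hx => ?_, by rw [card_erase_of_mem hv]; omega⟩
      rw [mem_erase] at hx
      exact mem_filter.2 ⟨hsW hx.2, hcl hv hx.2 hx.1.symm⟩
    · intro s hs t ht hst
      simp only [coe_filter, Set.mem_ofPred_eq] at hs ht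
      rw [← insert_erase hs.2, ← insert_erase ht.2]
      exact congrArg _ hst
    · rw [card_powersetCard]
      exact Nat.choose_le_choose _ hm
  have := card_filter_add_card_filter_not (s := S) (fun s => v ∉ s)
  simp only [not_not] at this
  change #S ≤ _
  omega

/-- Removing the vertices of `T` one by one. -/
lemma cliqueCount_union_le {p m : ℕ} {U T : Finset V} (hUT : Disjoint U T)
    (hm : ∀ v ∈ T, #{x ∈ U ∪ T | G.Adj v x} ≤ m) :
    cliqueCount G (p + 1) (U ∪ T) ≤ cliqueCount G (p + 1) U + #T * m.choose p := by
  induction T using Finset.induction_on with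
  | empty => simp
  | insert v T hv ih =>
    have h₁ := ih (disjoint_of_subset_right (subset_insert _ _) hUT) (fun w hw =>
      (card_le_card (filter_subset_filter _
        (union_subset_union_right (subset_insert _ _)))).trans (hm w (mem_insert_of_mem hw)))
    have h₂ := cliqueCount_le_erase (p := p) (hm v (mem_insert_self _ _))
    have h₃ : (U ∪ insert v T).erase v = U ∪ T := by
      have : v ∉ U := fun h => (disjoint_left.1 hUT h) (mem_insert_self _ _)
      rw [union_insert, erase_insert (by simp [this, hv])]
    rw [h₃] at h₂
    rw [card_insert_of_notMem hv, add_mul]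
    omega

lemma cliqueCount_le_of_subset {p m : ℕ} {U W : Finset V} (hUW : U ⊆ W)
    (hm : ∀ v ∈ W, v ∉ U → #{x ∈ W | G.Adj v x} ≤ m) :
    cliqueCount G (p + 1) W ≤ cliqueCount G (p + 1) U + (#W - #U) * m.choose p := by
  have := cliqueCount_union_le (G := G) (p := p) (m := m) (disjoint_sdiff (s := U) (t := W))
    (by
      rw [union_sdiff_of_subset hUW]
      intro v hv
      exact hm v (mem_sdiff.1 hv).1 (mem_sdiff.1 hv).2)
  rwa [union_sdiff_of_subset hUW, card_sdiff_of_subset hUW] at this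

/-- Repeatedly removing vertices of degree at most `m` leaves the `(m + 1)`-core. -/
lemma exists_core (G : SimpleGraph V) (p m : ℕ) (W : Finset V) :
    ∃ K ⊆ W, (∀ v ∈ K, m < #{x ∈ K | G.Adj v x}) ∧
      (∀ v ∈ W, v ∉ K → #{x ∈ K | G.Adj v x} ≤ m) ∧
      cliqueCount G (p + 1) W ≤ cliqueCount G (p + 1) K + (#W - #K) * m.choose p := by
  induction W using Finset.strongInduction with
  | H W ih =>
    by_cases h : ∀ v ∈ W, m < #{x ∈ W | G.Adj v x}
    · exact ⟨W, Subset.rfl, h, fun v h₁ h₂ => absurd h₁ h₂, by simp⟩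
    · push Not at h
      obtain ⟨v, hv, hm⟩ := h
      obtain ⟨K, hK, h₁, h₂, h₃⟩ := ih _ (erase_ssubset hv)
      have hKW := hK.trans (erase_subset _ _)
      refine ⟨K, hKW, h₁, fun w hw hwK => ?_, ?_⟩
      · by_cases hwv : w = v
        · subst hwv
          exact (card_le_card (filter_subset_filter _ hKW)).trans hm
        · exact h₂ w (mem_erase.2 ⟨hwv, hw⟩) hwK
      · have h₄ := cliqueCount_le_erase (p := p) hm
        have h₅ := card_le_card hK
        rw [card_erase_of_mem hv] at h₃ h₅
        have h₆ : 0 < #W := card_pos.2 ⟨v, hv⟩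
        have : #W - #K = (#W - 1 - #K) + 1 := by omega
        rw [this, add_mul]
        omega

end CliqueCount

section Binomials

lemma choose_succ_mul_le (m j : ℕ) (hj : j ≤ m) : (m + 1).choose j ≤ (m + 1) * m.choose j := by
  have h := Nat.choose_mul_succ_eq m j
  have : 1 ≤ m + 1 - j := by omega
  calc (m + 1).choose j ≤ (m + 1).choose j * (m + 1 - j) := Nat.le_mul_of_pos_right _ this
    _ = (m + 1) * m.choose j := by rw [← h, mul_comm]

/-- Lowering the upper index by two and the lower index by one costs a linear factor. -/
lemma choose_add_two_le (s j : ℕ) (hj : j ≤ s) :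
    (s + 2).choose (j + 1) ≤ (s + 2) * s.choose j := by
  have h₁ := Nat.add_one_mul_choose_eq (s + 1) j
  have h₂ := Nat.choose_mul_succ_eq s j
  have h₃ : (s + 2).choose (j + 1) * ((j + 1) * (s + 1 - j)) =
      (s + 2) * (s + 1) * s.choose j := by
    calc _ = ((s + 1 + 1).choose (j + 1) * (j + 1)) * (s + 1 - j) := by ring
      _ = (s + 2) * ((s + 1).choose j * (s + 1 - j)) := by rw [← h₁]; ring
      _ = _ := by rw [← h₂]; ring
  have h₄ : s + 1 ≤ (j + 1) * (s + 1 - j) := by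
    obtain ⟨i, rfl⟩ := Nat.exists_eq_add_of_le hj
    have : j + i + 1 - j = i + 1 := by omega
    rw [this]
    nlinarith
  refine Nat.le_of_mul_le_mul_right (c := s + 1) ?_ (by omega)
  calc _ ≤ (s + 2).choose (j + 1) * ((j + 1) * (s + 1 - j)) := Nat.mul_le_mul_left _ h₄
    _ = _ := by rw [h₃]; ring

/-- A discretely convex function on an interval is bounded by its values at the ends. -/
lemma le_max_of_convex (g : ℕ → ℤ) (m : ℕ)
    (hg : ∀ i, i + 2 ≤ m → g (i + 1) - g i ≤ g (i + 2) - g (i + 1)) {d i : ℕ}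
    (hdi : d ≤ i) (him : i ≤ m) : g i ≤ max (g d) (g m) := by
  by_contra! h
  rw [max_lt_iff] at h
  have h₁ : ∃ j, j + 1 ≤ i ∧ g j < g (j + 1) := by
    by_contra! hcon
    have : ∀ e, d + e ≤ i → g (d + e) ≤ g d := by
      intro e
      induction e with
      | zero => simp
      | succ e ih =>
        intro he
        exact (hcon (d + e) (by omega)).trans (ih (by omega))
    have := this (i - d) (by omega)
    rw [Nat.add_sub_cancel' hdi] at this
    omega
  obtain ⟨j, hj, hlt⟩ := h₁
  have h₂ : ∀ e, j + e + 1 ≤ m → g (j + e) < g (j + e + 1) := by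
    intro e
    induction e with
    | zero => intro _; exact hlt
    | succ e ih =>
      intro he
      have := hg (j + e) (by omega)
      have := ih (by omega)
      rw [show j + (e + 1) = j + e + 1 by ring, show j + e + 1 + 1 = j + e + 2 by ring]
      omega
  have h₃ : ∀ e, i + e ≤ m → g i ≤ g (i + e) := by
    intro e
    induction e with
    | zero => simp
    | succ e ih =>
      intro he
      have := h₂ (i + e - j) (by omega)
      rw [show j + (i + e - j) = i + e by omega] at this
      have := ih (by omega)
      rw [← add_assoc]
      omega
  have := h₃ (m - i) (by omega)
  rw [Nat.add_sub_cancel' him] at this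
  omega

lemma hr_le_max {r n k m d i : ℕ} (hr1 : 2 ≤ r) (hn : k ≤ n) (hm : m ≤ k) (hdi : d ≤ i)
    (him : i ≤ m) : hr r n k i ≤ max (hr r n k d) (hr r n k m) := by
  refine le_max_of_convex (hr r n k) m ?_ hdi him
  intro a ha
  obtain ⟨q, rfl⟩ : ∃ q, r = q + 2 := ⟨r - 2, by omega⟩
  obtain ⟨b, rfl⟩ : ∃ b, k = a + 2 + b := ⟨k - (a + 2), by omega⟩
  obtain ⟨c, rfl⟩ : ∃ c, n = a + 2 + b + c := ⟨n - (a + 2 + b), by omega⟩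
  have e₀ : a + 2 + b - a = b + 2 := by omega
  have e₁ : a + 2 + b - (a + 1) = b + 1 := by omega
  have e₂ : a + 2 + b - (a + 2) = b := by omega
  have hmono : a.choose q ≤ (a + 1).choose q := Nat.choose_le_choose _ (by omega)
  have hmono' : b.choose (q + 1) ≤ (b + 1).choose (q + 1) := Nat.choose_le_choose _ (by omega)
  have p₁ := Nat.choose_succ_succ' (b + 1) (q + 1)
  have p₂ := Nat.choose_succ_succ' b (q + 1)
  have p₃ := Nat.choose_succ_succ' a q
  have p₄ := Nat.choose_succ_succ' (a + 1) q
  simp only [hr, e₀, e₁, e₂, show q + 2 - 1 = q + 1 by omega]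
  zify at hmono hmono' p₁ p₂ p₃ p₄
  rw [show b + 1 + 1 = b + 2 by ring, show q + 1 + 1 = q + 2 by ring] at *
  rw [show a + 1 + 1 = a + 2 by ring] at p₄
  push_cast
  rw [p₁, p₂, p₄, p₃]
  nlinarith [mul_nonneg (Int.natCast_nonneg (a + c)) (sub_nonneg.2 hmono)]

lemma choose_add_five (a p : ℕ) : (a + 5).choose (p + 1) = a.choose (p + 1) + a.choose p +
    (a + 1).choose p + (a + 2).choose p + (a + 3).choose p + (a + 4).choose p := by
  simp only [Nat.choose_succ_succ' _ p]
  ring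

lemma two_mul_choose_succ_le (a p : ℕ) :
    2 * (a + 1).choose p ≤ a.choose p + (a + 2).choose p := by
  cases p with
  | zero => simp
  | succ p =>
    have : a.choose p ≤ (a + 1).choose p := Nat.choose_le_succ a p
    simp only [Nat.choose_succ_succ' _ p]
    omega

lemma mul_choose_add_le {s j a N X : ℕ} (hj : j ≤ s) (ha : a ≤ s)
    (hX : X ≤ 2 * (2 * s + 7) * (2 * s + 7) + s) (hN : (2 * s + 7) ^ 5 < N) :
    X * (s + 4).choose (j + 1) + N * a.choose (j + 1) + (s + 6) * (s + 1).choose (j + 1) ≤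
      N * (s + 1).choose (j + 1) := by
  have h₁ : (s + 4).choose (j + 1) ≤ (s + 4) * (s + 3) * (s + 2) * s.choose j := by
    calc (s + 4).choose (j + 1) ≤ (s + 4) * (s + 3).choose (j + 1) :=
          choose_succ_mul_le _ _ (by omega)
      _ ≤ (s + 4) * ((s + 3) * (s + 2).choose (j + 1)) :=
          Nat.mul_le_mul_left _ (choose_succ_mul_le _ _ (by omega))
      _ ≤ (s + 4) * ((s + 3) * ((s + 2) * s.choose j)) :=
          Nat.mul_le_mul_left _ (Nat.mul_le_mul_left _ (choose_add_two_le _ _ hj))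
      _ = _ := by ring
  have h₂ : a.choose (j + 1) ≤ s.choose (j + 1) := Nat.choose_mono _ ha
  have h₃ := Nat.choose_succ_succ' s j
  have h₄ : (s + 1).choose (j + 1) ≤ (s + 4).choose (j + 1) := Nat.choose_mono _ (by omega)
  have h₅ : (X + (s + 6)) * ((s + 4) * (s + 3) * (s + 2)) ≤ N := by
    refine le_trans ?_ hN.le
    calc (X + (s + 6)) * ((s + 4) * (s + 3) * (s + 2))
        ≤ (2 * (2 * s + 7) * (2 * s + 7) + s + (s + 6)) * ((s + 4) * (s + 3) * (s + 2)) :=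
          Nat.mul_le_mul_right _ (by omega)
      _ ≤ (2 * s + 7) ^ 5 := by
          ring_nf
          gcongr <;> norm_num
  calc X * (s + 4).choose (j + 1) + N * a.choose (j + 1) + (s + 6) * (s + 1).choose (j + 1)
      ≤ (X + (s + 6)) * (s + 4).choose (j + 1) + N * s.choose (j + 1) := by nlinarith
    _ ≤ (X + (s + 6)) * ((s + 4) * (s + 3) * (s + 2) * s.choose j) + N * s.choose (j + 1) :=
        Nat.add_le_add_right (Nat.mul_le_mul_left _ h₁) _
    _ = (X + (s + 6)) * ((s + 4) * (s + 3) * (s + 2)) * s.choose j + N * s.choose (j + 1) := by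
        ring
    _ ≤ N * s.choose j + N * s.choose (j + 1) :=
        Nat.add_le_add_right (Nat.mul_le_mul_right _ h₅) _
    _ = N * (s + 1).choose (j + 1) := by rw [h₃]; ring

end Binomials

section Structure

open Classical Finset

variable {V : Type*} {G : SimpleGraph V}

lemma exists_insert_adjCount {w : V} (hw : ∀ x, x ≠ w → G.Adj w x) (l : List V) (hl : l.Nodup)
    (hwl : w ∉ l) (hlen : adjCount G l + 1 < l.length) :
    ∃ l' : List V, l'.Nodup ∧ l'.toFinset = insert w l.toFinset ∧
      adjCount G l' = adjCount G l + 2 := by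
  obtain ⟨p, x, y, q, rfl, hxy⟩ := exists_not_adj_split l hlen
  have hperm : ((p ++ [x]) ++ w :: (y :: q)).Perm (w :: (p ++ x :: y :: q)) := by
    refine List.perm_middle.trans ?_
    simp
  refine ⟨(p ++ [x]) ++ w :: (y :: q), hperm.nodup_iff.2 (List.nodup_cons.2 ⟨hwl, hl⟩),
    by rw [List.toFinset_eq_of_perm _ _ hperm, List.toFinset_cons], ?_⟩
  have hx : x ≠ w := by rintro rfl; simp at hwl
  have hy : y ≠ w := by rintro rfl; simp at hwl
  rw [show p ++ x :: y :: q = (p ++ [x]) ++ y :: q by simp,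
    adjCount_append, adjCount_append _ (y :: q)]
  simp [adjInd_of_not_adj hxy, adjInd_of_adj (hw x hx).symm, adjInd_of_adj (hw y hy),
    List.getLast?_append]
  omega

lemma idxOf_toList_lt {T : Finset V} {v : V} (hv : v ∈ T) (l : List V) :
    (T.toList ++ l).idxOf v < #T := by
  rw [List.idxOf_append_of_mem (mem_toList.2 hv), ← length_toList]
  exact List.idxOf_lt_length_of_mem (mem_toList.2 hv)

lemma idxOf_toList_append {T : Finset V} {v : V} (hv : v ∉ T) (l : List V) :
    (T.toList ++ l).idxOf v = #T + l.idxOf v := by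
  rw [List.idxOf_append_of_notMem (by simpa using hv), length_toList]

lemma nodup_toList_append {T : Finset V} {l : List V} (hl : l.Nodup) (h : ∀ x ∈ l, x ∉ T) :
    (T.toList ++ l).Nodup := by
  rw [List.nodup_append]
  refine ⟨T.nodup_toList, hl, ?_⟩
  rintro a ha b hb rfl
  exact h a hb (mem_toList.1 ha)

variable [Fintype V]

/-- Universal vertices absorb two additional adjacent pairs each. -/
lemma adjCount_add_two_mul_card_lt {k : ℕ} (hG : PairBounded k G) (A : Finset V)
    (hA : ∀ v ∈ A, ∀ w, w ≠ v → G.Adj v w) (hn : #A + k < Fintype.card V) (l : List V)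
    (hl : l.Nodup) (hlA : ∀ x ∈ l, x ∉ A) : adjCount G l + 2 * #A < k := by
  have key : ∀ B ⊆ A, ∃ l' : List V, l'.Nodup ∧ l'.toFinset = Aᶜ ∪ B ∧
      adjCount G l + 2 * #B ≤ adjCount G l' := by
    intro B
    induction B using Finset.induction_on with
    | empty =>
      intro _
      obtain ⟨l', h₁, h₂⟩ := exists_append_nodup Aᶜ l hl (by simpa using hlA)
      refine ⟨l ++ l', h₁, by simpa using h₂, ?_⟩
      have := add_adjCount_le_append (G := G) l l'
      simp
      omega
    | insert w B hw ih =>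
      intro hB
      have hwA := hB (mem_insert_self _ _)
      obtain ⟨l', h₁, h₂, h₃⟩ := ih ((subset_insert _ _).trans hB)
      have hlen : adjCount G l' + 1 < l'.length := by
        have h₄ := hG l' h₁
        have h₅ : #(Aᶜ) ≤ #(l'.toFinset) := card_le_card (by rw [h₂]; exact subset_union_left)
        rw [List.toFinset_card_of_nodup h₁, card_compl] at h₅
        omega
      have hwl : w ∉ l' := by
        rw [← List.mem_toFinset, h₂]
        simp [hw, hwA]
      obtain ⟨l'', g₁, g₂, g₃⟩ := exists_insert_adjCount (hA w hwA) l' h₁ hwl hlen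
      refine ⟨l'', g₁, by rw [g₂, h₂, union_insert], ?_⟩
      rw [card_insert_of_notMem hw]
      omega
  obtain ⟨l', h₁, -, h₂⟩ := key A Subset.rfl
  exact h₂.trans_lt (hG l' h₁)

lemma exists_embedding_idxOf {n : ℕ} (hn : Fintype.card V = n) (l : List V) (hl : l.Nodup) :
    ∃ f : V ↪ Fin n, ∀ v ∈ l, (f v : ℕ) = l.idxOf v := by
  obtain ⟨l', h₁, h₂⟩ := exists_append_nodup univ l hl (by simp)
  have hmem : ∀ v, v ∈ l ++ l' := fun v => by rw [← List.mem_toFinset, h₂]; simp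
  have hlen : (l ++ l').length = n := by
    rw [← List.toFinset_card_of_nodup h₁, h₂, card_univ, hn]
  refine ⟨⟨fun v => ⟨(l ++ l').idxOf v, by
    rw [← hlen]; exact List.idxOf_lt_length_of_mem (hmem v)⟩, ?_⟩, ?_⟩
  · intro u v huv
    simp only [Fin.mk.injEq] at huv
    exact (List.idxOf_inj (hmem u)).1 huv
  · intro v hv
    exact List.idxOf_append_of_mem hv

lemma isoSubgraph_HGraph_of_cover {n k a : ℕ} (hn : Fintype.card V = n) (T : Finset V)
    (hT : #T ≤ a) (h : ∀ u v, G.Adj u v → u ∈ T ∨ v ∈ T) : IsoSubgraph G (HGraph n k a) := by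
  obtain ⟨f, hf⟩ := exists_embedding_idxOf hn (T.toList ++ []) (by simpa using T.nodup_toList)
  have hfT : ∀ v ∈ T, (f v : ℕ) < a := fun v hv => by
    rw [hf v (by simpa using hv)]
    exact (idxOf_toList_lt hv _).trans_le hT
  refine ⟨f, fun u v huv => ?_⟩
  rw [HGraph, fromRel_adj]
  refine ⟨fun e => huv.ne (f.injective e), ?_⟩
  rcases h u v huv with h | h
  · exact Or.inl (Or.inl (hfT u h))
  · exact Or.inr (Or.inl (hfT v h))

lemma isoSubgraph_HGraph_of_triangle {n k : ℕ} (hn : Fintype.card V = n) (A : Finset V)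
    (hk : #A + 3 ≤ k - #A) (x y z : V) (hnd : [x, y, z].Nodup) (hA : ∀ w ∈ [x, y, z], w ∉ A)
    (h : ∀ u v, G.Adj u v → u ∉ A → v ∉ A → u ∈ [x, y, z]) :
    IsoSubgraph G (HGraph n k #A) := by
  obtain ⟨f, hf⟩ := exists_embedding_idxOf hn _ (nodup_toList_append hnd hA)
  have hfA : ∀ v ∈ A, (f v : ℕ) < #A := fun v hv => by
    rw [hf v (by simp [hv])]
    exact idxOf_toList_lt hv _
  have hfl : ∀ v ∈ [x, y, z], (f v : ℕ) < k - #A := fun v hv => by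
    rw [hf v (List.mem_append_right _ hv), idxOf_toList_append (hA v hv)]
    have := List.idxOf_lt_length_of_mem hv
    simp at this ⊢
    omega
  refine ⟨f, fun u v huv => ?_⟩
  rw [HGraph, fromRel_adj]
  refine ⟨fun e => huv.ne (f.injective e), ?_⟩
  by_cases hu : u ∈ A
  · exact Or.inl (Or.inl (hfA u hu))
  · by_cases hv : v ∈ A
    · exact Or.inr (Or.inl (hfA v hv))
    · exact Or.inl (Or.inr ⟨hfl u (h u v huv hu hv), hfl v (h v u huv.symm hv hu)⟩)

lemma isoSubgraph_HplusGraph_of_pairs {n k : ℕ} (hn : Fintype.card V = n) (A : Finset V)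
    (hk : #A + 2 = k - #A) (x y z w : V) (hnd : [x, y, z, w].Nodup)
    (hA : ∀ v ∈ [x, y, z, w], v ∉ A)
    (h : ∀ u v, G.Adj u v → u ∉ A → v ∉ A →
      s(u, v) = s(x, y) ∨ s(u, v) = s(z, w)) :
    IsoSubgraph G (HplusGraph n k #A) := by
  obtain ⟨f, hf⟩ := exists_embedding_idxOf hn _ (nodup_toList_append hnd hA)
  have hfA : ∀ v ∈ A, (f v : ℕ) < #A := fun v hv => by
    rw [hf v (by simp [hv])]
    exact idxOf_toList_lt hv _
  have hfl : ∀ v ∈ [x, y, z, w], (f v : ℕ) = #A + [x, y, z, w].idxOf v := fun v hv => by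
    rw [hf v (List.mem_append_right _ hv), idxOf_toList_append (hA v hv)]
  simp only [List.nodup_cons, List.mem_cons, not_or, List.not_mem_nil] at hnd
  have hx : (f x : ℕ) = #A := by simpa using hfl x (by simp)
  have hy : (f y : ℕ) = #A + 1 := by
    rw [hfl y (by simp), List.idxOf_cons_ne _ (by tauto), List.idxOf_cons_self]
  have hz : (f z : ℕ) = #A + 2 := by
    rw [hfl z (by simp), List.idxOf_cons_ne _ (by tauto), List.idxOf_cons_ne _ (by tauto),
      List.idxOf_cons_self]
  have hw : (f w : ℕ) = #A + 3 := by
    rw [hfl w (by simp), List.idxOf_cons_ne _ (by tauto), List.idxOf_cons_ne _ (by tauto),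
      List.idxOf_cons_ne _ (by tauto), List.idxOf_cons_self]
  refine ⟨f, fun u v huv => ?_⟩
  rw [HplusGraph, fromRel_adj]
  refine ⟨fun e => huv.ne (f.injective e), ?_⟩
  by_cases hu : u ∈ A
  · exact Or.inl (Or.inl (hfA u hu))
  · by_cases hv : v ∈ A
    · exact Or.inr (Or.inl (hfA v hv))
    · rcases h u v huv hu hv with h | h <;> rw [Sym2.eq_iff] at h <;>
        rcases h with ⟨rfl, rfl⟩ | ⟨rfl, rfl⟩ <;> omega

lemma isoSubgraph_of_adjCount_le_two {n t : ℕ} (hn : Fintype.card V = n) (A : Finset V)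
    (hA : #A + 1 = t)
    (h : ∀ l : List V, l.Nodup → (∀ x ∈ l, x ∉ A) → adjCount G l ≤ 2) :
    IsoSubgraph G (HGraph n (2 * t + 1) t) ∨ IsoSubgraph G (HGraph n (2 * t + 1) (t - 1)) ∨
      IsoSubgraph G (HplusGraph n (2 * t) (t - 1)) := by
  have htA : t - 1 = #A := by omega
  by_cases hE : ∃ x y, x ∉ A ∧ y ∉ A ∧ G.Adj x y
  swap
  · refine Or.inl (isoSubgraph_HGraph_of_cover hn A (by omega) fun u v huv => ?_)
    by_contra! hcon
    exact hE ⟨u, v, hcon.1, hcon.2, huv⟩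
  by_cases hS : ∃ x y z, x ∉ A ∧ y ∉ A ∧ z ∉ A ∧ y ≠ z ∧ G.Adj x y ∧ G.Adj x z
  · obtain ⟨x, y, z, hx, hy, hz, hyz, hxy, hxz⟩ := hS
    have nxy := hxy.ne
    have nxz := hxz.ne
    by_cases hT : G.Adj y z
    · refine Or.inr (Or.inl ?_)
      rw [htA]
      refine isoSubgraph_HGraph_of_triangle hn A (by omega) x y z
        (by simp; tauto) (by simp; tauto) ?_
      intro p q hpq hp hq
      have npq := hpq.ne
      by_contra hmem
      simp only [List.mem_cons, List.not_mem_nil, or_false, not_or] at hmem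
      by_cases hqx : q = x
      · subst hqx
        have := h [p, q, y, z] (by simp; tauto) (by simp; tauto)
        simp [adjInd_of_adj hpq, adjInd_of_adj hxy, adjInd_of_adj hT] at this
      by_cases hqy : q = y
      · subst hqy
        have := h [p, q, x, z] (by simp; tauto) (by simp; tauto)
        simp [adjInd_of_adj hpq, adjInd_of_adj hxy.symm, adjInd_of_adj hxz] at this
      by_cases hqz : q = z
      · subst hqz
        have := h [p, q, x, y] (by simp; tauto) (by simp; tauto)
        simp [adjInd_of_adj hpq, adjInd_of_adj hxz.symm, adjInd_of_adj hxy] at this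
      have := h [y, x, z, p, q] (by simp; tauto) (by simp; tauto)
      simp [adjInd_of_adj hpq, adjInd_of_adj hxz, adjInd_of_adj hxy.symm] at this
      omega
    · refine Or.inl (isoSubgraph_HGraph_of_cover hn (insert x A)
        (by rw [card_insert_of_notMem hx]; omega) fun p q hpq => ?_)
      have npq := hpq.ne
      by_contra! hcon
      simp only [mem_insert, not_or] at hcon
      obtain ⟨⟨hpx, hp⟩, hqx, hq⟩ := hcon
      have key : ∀ p q, G.Adj p q → p ∉ A → q ∉ A → p ≠ x → q ≠ x → p ≠ y ∧ p ≠ z := by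
        clear hpq npq hpx hp hqx hq p q
        intro p q hpq hp hq hpx hqx
        have npq := hpq.ne
        constructor
        · rintro rfl
          have hqz : q ≠ z := by rintro rfl; exact hT hpq
          have := h [q, p, x, z] (by simp; tauto) (by simp; tauto)
          simp [adjInd_of_adj hpq.symm, adjInd_of_adj hxy.symm, adjInd_of_adj hxz] at this
        · rintro rfl
          have hqy : q ≠ y := by rintro rfl; exact hT hpq.symm
          have := h [q, p, x, y] (by simp; tauto) (by simp; tauto)
          simp [adjInd_of_adj hpq.symm, adjInd_of_adj hxz.symm, adjInd_of_adj hxy] at this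
      have k₁ := key p q hpq hp hq hpx hqx
      have k₂ := key q p hpq.symm hq hp hqx hpx
      have := h [y, x, z, p, q] (by simp; tauto) (by simp; tauto)
      simp [adjInd_of_adj hpq, adjInd_of_adj hxz, adjInd_of_adj hxy.symm] at this
      omega
  · obtain ⟨x, y, hx, hy, hxy⟩ := hE
    have nxy := hxy.ne
    have huniq : ∀ p q q', p ∉ A → q ∉ A → q' ∉ A → G.Adj p q → G.Adj p q' → q = q' := by
      intro p q q' h₁ h₂ h₃ h₄ h₅
      by_contra hne
      exact hS ⟨p, q, q', h₁, h₂, h₃, hne, h₄, h₅⟩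
    have hdisj : ∀ p q p' q', p ∉ A → q ∉ A → p' ∉ A → q' ∉ A → G.Adj p q → G.Adj p' q' →
        s(p', q') ≠ s(p, q) → p ≠ p' ∧ p ≠ q' ∧ q ≠ p' ∧ q ≠ q' := by
      intro p q p' q' h₁ h₂ h₃ h₄ h₅ h₆ hne
      refine ⟨?_, ?_, ?_, ?_⟩
      · rintro rfl
        exact hne (by rw [huniq p q' q h₁ h₄ h₂ h₆ h₅])
      · rintro rfl
        exact hne (by rw [huniq p p' q h₁ h₃ h₂ h₆.symm h₅, Sym2.eq_swap])
      · rintro rfl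
        exact hne (by rw [huniq q q' p h₂ h₄ h₁ h₆ h₅.symm, Sym2.eq_swap])
      · rintro rfl
        exact hne (by rw [huniq q p' p h₂ h₃ h₁ h₆.symm h₅.symm])
    by_cases hM : ∃ z w, z ∉ A ∧ w ∉ A ∧ G.Adj z w ∧ s(z, w) ≠ s(x, y)
    · obtain ⟨z, w, hz, hw, hzw, hne⟩ := hM
      have nzw := hzw.ne
      have d₁ := hdisj x y z w hx hy hz hw hxy hzw hne
      refine Or.inr (Or.inr ?_)
      rw [htA]
      refine isoSubgraph_HplusGraph_of_pairs hn A (by omega) x y z w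
        (by simp; tauto) (by simp; tauto) ?_
      intro p q hpq hp hq
      have npq := hpq.ne
      by_contra! hcon
      have d₂ := hdisj x y p q hx hy hp hq hxy hpq hcon.1
      have d₃ := hdisj z w p q hz hw hp hq hzw hpq hcon.2
      have := h [x, y, z, w, p, q] (by simp; tauto) (by simp; tauto)
      simp [adjInd_of_adj hpq, adjInd_of_adj hxy, adjInd_of_adj hzw] at this
      omega
    · refine Or.inl (isoSubgraph_HGraph_of_cover hn (insert x A)
        (by rw [card_insert_of_notMem hx]; omega) fun p q hpq => ?_)
      by_contra! hcon
      simp only [mem_insert, not_or] at hcon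
      refine hM ⟨p, q, hcon.1.2, hcon.2.2, hpq, fun he => ?_⟩
      rw [Sym2.eq_iff] at he
      tauto

end Structure

section Counting

open Classical Finset

variable {V : Type*} {G : SimpleGraph V}

lemma adjCount_toList_of_isClique {K : Finset V} (hK : G.IsClique (K : Set V)) :
    adjCount G K.toList + 1 = #K ∨ #K = 0 := by
  have : ∀ l : List V, l.Nodup → (∀ x ∈ l, x ∈ K) → adjCount G l + 1 = l.length ∨ l = [] := by
    intro l
    induction l with
    | nil => simp
    | cons x l ih =>
      intro hl hmem
      left
      cases l with
      | nil => simp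
      | cons y l =>
        rcases ih hl.of_cons (fun z hz => hmem z (List.mem_cons_of_mem _ hz)) with h | h
        · have hxy : x ≠ y := by rintro rfl; simp at hl
          rw [adjCount_cons_cons,
            adjInd_of_adj (hK (hmem x (by simp)) (hmem y (by simp)) hxy)]
          simp at h ⊢
          omega
        · simp at h
  have := this K.toList K.nodup_toList (by simp)
  simpa using this

/-- In a graph of maximum degree at most two, a maximum linear forest yields a vertex cover. -/
lemma exists_cover_of_degree_le_two (U : Finset V) (hdeg : ∀ v ∈ U, #{x ∈ U | G.Adj v x} ≤ 2)
    (j : ℕ) (hj : ∀ l : List V, l.Nodup → (∀ x ∈ l, x ∈ U) → adjCount G l ≤ j) :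
    ∃ T ⊆ U, #T ≤ j ∧ ∀ u ∈ U, ∀ v ∈ U, G.Adj u v → u ∈ T ∨ v ∈ T := by
  induction U using Finset.strongInduction generalizing j with
  | H U ih =>
    have step : ∀ (l : List V), l.Nodup → (∀ x ∈ l, x ∈ U) → l ≠ [] → ∀ T₀ : Finset V,
        (∀ x ∈ T₀, x ∈ l) → #T₀ ≤ adjCount G l →
        (∀ u ∈ l, ∀ v ∈ U, G.Adj u v → u ∈ T₀ ∨ v ∈ T₀) →
        ∃ T ⊆ U, #T ≤ j ∧ ∀ u ∈ U, ∀ v ∈ U, G.Adj u v → u ∈ T ∨ v ∈ T := by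
      intro l hl hlU hne T₀ hT₀ hcard hcov
      have hss : U \ l.toFinset ⊂ U := by
        obtain ⟨x, hx⟩ := List.exists_mem_of_ne_nil l hne
        refine ⟨sdiff_subset, fun h => ?_⟩
        have := h (hlU x hx)
        simp [hx] at this
      have hjl := hj l hl hlU
      obtain ⟨T, hT, hTc, hTcov⟩ := ih _ hss (fun v hv =>
        (card_le_card (filter_subset_filter _ sdiff_subset)).trans
          (hdeg v (mem_sdiff.1 hv).1)) (j - adjCount G l) (by
        intro l' hl' hlU'
        have hlU'' : ∀ x ∈ l', x ∈ U ∧ x ∉ l := fun x hx => by simpa using hlU' x hx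
        have := hj (l ++ l') (List.nodup_append.2 ⟨hl, hl', by
          rintro a ha b hb rfl
          exact (hlU'' a hb).2 ha⟩) (fun x hx => by
            rcases List.mem_append.1 hx with h | h
            · exact hlU x h
            · exact (hlU'' x h).1)
        have := add_adjCount_le_append (G := G) l l'
        omega)
      refine ⟨T₀ ∪ T, union_subset (fun x hx => hlU x (hT₀ x hx)) (hT.trans sdiff_subset),
        (card_union_le _ _).trans (by omega), ?_⟩
      intro u hu v hv huv
      by_cases hul : u ∈ l
      · have := hcov u hul v hv huv
        simp only [mem_union]
        tauto
      by_cases hvl : v ∈ l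
      · have := hcov v hvl u hu huv.symm
        simp only [mem_union]
        tauto
      · have := hTcov u (by simp [hu, hul]) v (by simp [hv, hvl]) huv
        simp only [mem_union]
        tauto
    by_cases h₂ : ∃ x ∈ U, ∃ y ∈ U, ∃ z ∈ U, y ≠ z ∧ G.Adj x y ∧ G.Adj x z
    · obtain ⟨x, hx, y, hy, z, hz, hyz, hxy, hxz⟩ := h₂
      have nxy := hxy.ne
      have nxz := hxz.ne
      have hN : ∀ w ∈ U, G.Adj x w → w = y ∨ w = z := by
        intro w hw hxw
        by_contra! hcon
        have : ({w, y, z} : Finset V) ⊆ {v ∈ U | G.Adj x v} := by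
          intro v
          simp only [mem_insert, mem_singleton, mem_filter]
          rintro (rfl | rfl | rfl) <;> tauto
        have := (card_le_card this).trans (hdeg x hx)
        rw [card_eq_three.2 ⟨w, y, z, hcon.1, hcon.2, hyz, rfl⟩] at this
        omega
      refine step [y, x, z] (by simp; tauto) (by simp; tauto) (by simp) {y, z} (by simp) ?_ ?_
      · rw [card_pair hyz]
        simp [adjInd_of_adj hxy.symm, adjInd_of_adj hxz]
      · intro u hu v hv huv
        simp at hu ⊢
        rcases hu with rfl | rfl | rfl
        · tauto
        · have := hN v hv huv
          tauto
        · tauto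
    · by_cases h₁ : ∃ x ∈ U, ∃ y ∈ U, G.Adj x y
      · obtain ⟨x, hx, y, hy, hxy⟩ := h₁
        have nxy := hxy.ne
        refine step [x, y] (by simp; tauto) (by simp; tauto) (by simp) {x} (by simp) ?_ ?_
        · simp [adjInd_of_adj hxy]
        · intro u hu v hv huv
          simp at hu ⊢
          rcases hu with rfl | rfl
          · tauto
          · right
            by_contra hne
            exact h₂ ⟨u, hy, v, hv, x, hx, hne, huv, hxy.symm⟩
      · exact ⟨∅, by simp, by simp, fun u hu v hv huv => absurd ⟨u, hu, v, hv, huv⟩ h₁⟩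

variable [Fintype V]

lemma adj_of_le_degree {k : ℕ} (hG : Maximal (PairBounded k) G) {v : V}
    (hv : k ≤ #{x | G.Adj v x}) {w : V} (hw : w ≠ v) : G.Adj v w := by
  by_contra h
  have := degree_add_degree_lt hG hw.symm h
  omega

/-- A graph with a large core has few cliques. -/
lemma cliqueCount_le_of_core {t p d : ℕ} (hG : Maximal (PairBounded (2 * t + 1)) G)
    (hn : 2 * t + 1 < Fintype.card V) (hd : ∀ v, d ≤ #{x | G.Adj v x}) (hp : 1 ≤ p)
    (K : Finset V) (hK : K.Nonempty)
    (hcore : ∀ v ∈ K, t + 1 < #{x ∈ K | G.Adj v x})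
    (hout : ∀ v ∉ K, #{x ∈ K | G.Adj v x} ≤ t + 1) :
    (cliqueCount G (p + 1) univ : ℤ) ≤
      max (hr (p + 1) (Fintype.card V) (2 * t + 1) d)
        (hr (p + 1) (Fintype.card V) (2 * t + 1) (t - 2)) := by
  have hmono : ∀ v, #{x ∈ K | G.Adj v x} ≤ #{x | G.Adj v x} := fun v =>
    card_le_card (filter_subset_filter _ (subset_univ _))
  have hcl : G.IsClique (K : Set V) := by
    intro u hu v hv huv
    by_contra h
    have := degree_add_degree_lt hG huv h
    have := hcore u hu
    have := hcore v hv
    have := hmono u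
    have := hmono v
    omega
  have hq₁ : #K ≤ 2 * t + 1 := by
    have := hG.1 K.toList K.nodup_toList
    have := adjCount_toList_of_isClique hcl
    omega
  have hlt : ∀ v ∈ K, #{x ∈ K | G.Adj v x} + 1 ≤ #K := by
    intro v hv
    rw [← card_erase_add_one hv]
    refine Nat.succ_le_succ (card_le_card fun x hx => ?_)
    rw [mem_filter] at hx
    exact mem_erase.2 ⟨hx.2.ne', hx.1⟩
  have hq₂ : t + 3 ≤ #K := by
    obtain ⟨v, hv⟩ := hK
    have := hcore v hv
    have := hlt v hv
    omega
  have hdeg : ∀ v ∉ K, #{x | G.Adj v x} ≤ 2 * t + 1 - #K := by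
    intro v hv
    have : ∃ x ∈ K, ¬ G.Adj v x := by
      by_contra! hcon
      have := hout v hv
      rw [filter_true_of_mem hcon] at this
      omega
    obtain ⟨x, hx, hvx⟩ := this
    have h₁ := degree_add_degree_lt hG (by rintro rfl; exact hv hx) hvx
    have h₂ : #K ≤ #{y | G.Adj x y} + 1 := by
      rw [← card_erase_add_one hx]
      refine Nat.succ_le_succ (card_le_card fun y hy => ?_)
      rw [mem_erase] at hy
      exact mem_filter.2 ⟨mem_univ _, hcl hx hy.2 hy.1.symm⟩
    omega
  have hd' : d ≤ 2 * t + 1 - #K := by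
    obtain ⟨v, -, hv⟩ := exists_mem_notMem_of_card_lt_card
      (show #K < #(univ : Finset V) by rw [card_univ]; omega)
    exact (hd v).trans (hdeg v hv)
  have hcount := cliqueCount_le_of_subset (p := p) (subset_univ K) (fun v _ hv => hdeg v hv)
  have hcK := cliqueCount_le_choose (G := G) (p + 1) K
  refine le_trans ?_ (hr_le_max (r := p + 1) (n := Fintype.card V) (by omega) hn.le
    (show t - 2 ≤ 2 * t + 1 by omega) hd' (by omega))
  rw [card_univ] at hcount
  rw [hr, Nat.sub_sub_self hq₁, Nat.add_sub_cancel, Nat.cast_sub hq₁]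
  have h₃ : (cliqueCount G (p + 1) univ : ℤ) ≤
      ((#K).choose (p + 1) + (Fintype.card V - #K) * (2 * t + 1 - #K).choose p : ℕ) := by
    exact_mod_cast hcount.trans (Nat.add_le_add_right hcK _)
  refine h₃.trans_eq ?_
  rw [Nat.cast_add, Nat.cast_mul, Nat.cast_sub (by omega)]
  ring

/-- Counting cliques by means of a vertex cover of the edges outside `A`. -/
lemma cliqueCount_add_le_of_cover (p m₁ m₂ : ℕ) (A T₁ T₂ : Finset V) (h₁ : Disjoint A T₁)
    (h₂ : Disjoint (A ∪ T₁) T₂)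
    (hcov : ∀ u v, u ∉ A → v ∉ A → G.Adj u v → u ∈ T₁ ∪ T₂ ∨ v ∈ T₁ ∪ T₂)
    (hm₁ : ∀ v ∈ T₁, #{x | G.Adj v x} ≤ m₁) (hm₂ : ∀ v ∈ T₂, #{x | G.Adj v x} ≤ m₂) :
    cliqueCount G (p + 1) univ + (#A + #T₁ + #T₂) * (#A).choose p ≤
      (#A).choose (p + 1) + Fintype.card V * (#A).choose p + #T₁ * m₁.choose p +
        #T₂ * m₂.choose p := by
  have hle : ∀ (W : Finset V) v, #{x ∈ W | G.Adj v x} ≤ #{x | G.Adj v x} := fun W v =>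
    card_le_card (filter_subset_filter _ (subset_univ _))
  have d₁ : Disjoint (T₁ ∪ T₂)ᶜ T₁ :=
    disjoint_compl_left.mono_right subset_union_left
  have d₂ : Disjoint ((T₁ ∪ T₂)ᶜ ∪ T₁) T₂ := by
    rw [disjoint_union_left] at h₂ ⊢
    exact ⟨disjoint_compl_left.mono_right subset_union_right, h₂.2⟩
  have e : (T₁ ∪ T₂)ᶜ ∪ T₁ ∪ T₂ = univ := by
    rw [union_assoc, union_comm, union_compl]
  have c₁ := cliqueCount_union_le (G := G) (p := p) d₁ (fun v hv => (hle _ v).trans (hm₁ v hv))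
  have c₂ := cliqueCount_union_le (G := G) (p := p) d₂ (fun v hv => (hle _ v).trans (hm₂ v hv))
  rw [e] at c₂
  have hAT : A ⊆ (T₁ ∪ T₂)ᶜ := by
    rw [subset_compl_iff_disjoint_right, disjoint_union_right]
    rw [disjoint_union_left] at h₂
    exact ⟨h₁, h₂.1⟩
  have c₃ := cliqueCount_le_of_subset (G := G) (p := p) (m := #A) hAT (by
    intro v hv hvA
    refine card_le_card fun x hx => ?_
    rw [mem_filter] at hx
    by_contra hxA
    rw [mem_compl] at hv hx
    rcases hcov v x hvA hxA hx.2 with h | h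
    · exact hv h
    · exact hx.1 h)
  have c₄ := cliqueCount_le_choose (G := G) (p + 1) A
  have hcard : #((T₁ ∪ T₂)ᶜ) + (#T₁ + #T₂) = Fintype.card V := by
    rw [disjoint_union_left] at h₂
    rw [← card_union_of_disjoint h₂.2, card_compl_add_card]
  have hcard' := card_le_card hAT
  obtain ⟨e, he⟩ := Nat.exists_eq_add_of_le hcard'
  rw [he, Nat.add_sub_cancel_left] at c₃
  rw [← hcard, he]
  nlinarith

lemma exists_nodup_le_adjCount {m : ℕ} (U S : Finset V)
    (hdeg : ∀ v ∈ U, #{x | G.Adj v x} ≤ m) (hS : S ⊆ U) (hadj : ∀ v ∈ S, ∃ w ∈ U, G.Adj v w)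
    (j : ℕ) (hj : 2 * j * (m + 1) ≤ #S) :
    ∃ l : List V, l.Nodup ∧ (∀ x ∈ l, x ∈ U) ∧ l.length = 2 * j ∧ j ≤ adjCount G l := by
  induction j with
  | zero => exact ⟨[], by simp⟩
  | succ j ih =>
    obtain ⟨l, hl, hU, hlen, hc⟩ := ih (by nlinarith)
    have hcard : #(l.toFinset.biUnion fun x => insert x ({y | G.Adj x y} : Finset V)) < #S := by
      refine (card_biUnion_le_card_mul _ _ (m + 1) fun x hx => ?_).trans_lt ?_
      · exact (card_insert_le _ _).trans (Nat.succ_le_succ (hdeg x (hU x (by simpa using hx))))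
      · have := l.toFinset_card_le
        have : #l.toFinset * (m + 1) ≤ 2 * j * (m + 1) :=
          Nat.mul_le_mul_right _ (by omega)
        nlinarith
    obtain ⟨v, hv, hvl⟩ := exists_mem_notMem_of_card_lt_card hcard
    obtain ⟨w, hw, hvw⟩ := hadj v hv
    simp only [mem_biUnion, List.mem_toFinset, mem_insert, mem_filter, mem_univ, true_and,
      not_exists, not_and, not_or] at hvl
    have hvl' : v ∉ l := fun h => (hvl v h).1 rfl
    have hwl : w ∉ l := fun h => (hvl w h).2 hvw.symm
    refine ⟨v :: w :: l, ?_, ?_, by simp [hlen]; omega, ?_⟩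
    · simp [hvl', hwl, hl, hvw.ne]
    · simp only [List.mem_cons]
      rintro x (rfl | rfl | hx)
      exacts [hS hv, hw, hU x hx]
    · have := add_adjCount_le_append (G := G) [v, w] l
      simp [adjInd_of_adj hvw] at this ⊢
      omega

/-- Few vertices have a neighbour of degree less than `n - 1`, apart from the universal ones. -/
lemma card_lt_of_pairBounded {t : ℕ} (hG : Maximal (PairBounded (2 * t + 1)) G) (A S : Finset V)
    (hA : ∀ v, v ∉ A → ∃ w, w ≠ v ∧ ¬ G.Adj v w) (hS : Disjoint S A)
    (hadj : ∀ v ∈ S, ∃ w, w ∉ A ∧ G.Adj v w) : #S < 2 * (2 * t + 1) * (2 * t + 1) := by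
  by_contra! hcon
  obtain ⟨l, hl, -, -, hc⟩ := exists_nodup_le_adjCount (G := G) (m := 2 * t) Aᶜ S (by
    intro v hv
    obtain ⟨w, hw, hvw⟩ := hA v (by simpa using hv)
    by_contra! h
    exact hvw (adj_of_le_degree hG (by omega) hw)) (by
    rwa [subset_compl_iff_disjoint_right]) (by simpa using hadj) _ hcon
  have := hG.1 l hl
  omega

/-- Bounding the degrees outside the set of universal vertices. -/
lemma degree_add_card_lt {t : ℕ} (hG : Maximal (PairBounded (2 * t + 1)) G) (A : Finset V)
    (hA : ∀ v, v ∈ A ↔ ∀ w, w ≠ v → G.Adj v w)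
    (hn : #A + 2 * (2 * t + 1) * (2 * t + 1) + 1 < Fintype.card V) {v : V} (hv : v ∉ A) :
    #{x | G.Adj v x} + #A < 2 * t + 1 := by
  have hA' : ∀ v, v ∉ A → ∃ w, w ≠ v ∧ ¬ G.Adj v w := fun v hv => by
    rw [hA] at hv
    push Not at hv
    exact hv
  set S : Finset V := {x | x ∉ A ∧ ∃ w, w ∉ A ∧ G.Adj x w} with hS
  have h₁ := card_lt_of_pairBounded hG A S hA'
    (disjoint_left.2 fun x hx => (mem_filter.1 hx).2.1) (fun x hx => (mem_filter.1 hx).2.2)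
  obtain ⟨c, -, hc⟩ := exists_mem_notMem_of_card_lt_card
    (show #(insert v (A ∪ S)) < #(univ : Finset V) by
      have := card_insert_le v (A ∪ S)
      have := card_union_le A S
      rw [card_univ]
      omega)
  simp only [mem_insert, mem_union, not_or] at hc
  have hcS : ∀ w, w ∉ A → ¬ G.Adj c w := by
    intro w hw hcw
    exact hc.2.2 (by simp only [hS, mem_filter, mem_univ, true_and]; exact ⟨hc.2.1, w, hw, hcw⟩)
  have := degree_add_degree_lt hG (Ne.symm hc.1) (fun h => hcS v hv h.symm)
  have : #A ≤ #{x | G.Adj c x} := card_le_card fun x hx => by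
    simp only [mem_filter, mem_univ, true_and]
    exact ((hA x).1 hx c (by rintro rfl; exact hc.2.1 hx)).symm
  omega

/-- Clique count when some vertex has three neighbours outside `A`, and none has four. -/
lemma cliqueCount_add_le_of_degree_eq_three {p : ℕ} (A : Finset V)
    (hdeg : ∀ v ∉ A, #{x | G.Adj v x} = #A + #{x | x ∉ A ∧ G.Adj v x})
    (hadj : ∀ u v, u ∉ A → v ∉ A → u ≠ v → ¬ G.Adj u v →
      #{x | x ∉ A ∧ G.Adj u x} + #{x | x ∉ A ∧ G.Adj v x} ≤ 4)
    (hl : ∀ l : List V, l.Nodup → (∀ x ∈ l, x ∉ A) → adjCount G l ≤ 4)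
    (hthree : ∀ v ∉ A, #{x | x ∉ A ∧ G.Adj v x} ≤ 3) {v : V} (hv : v ∉ A)
    (hv3 : #{x | x ∉ A ∧ G.Adj v x} = 3) :
    cliqueCount G (p + 1) univ + (#A + 5) * (#A).choose p ≤
      (#A + 5).choose (p + 1) + Fintype.card V * (#A).choose p := by
  set N : Finset V := {x | x ∉ A ∧ G.Adj v x} with hN
  have hv3' : #{x | x ∉ A ∧ G.Adj v x} = 3 := hv3
  have memN : ∀ x, x ∈ N ↔ x ∉ A ∧ G.Adj v x := by simp [hN]
  have hNd : ∀ x ∈ N, #{y | G.Adj x y} ≤ #A + 3 := fun x hx => by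
    have := ((memN x).1 hx).1
    rw [hdeg x this]
    exact Nat.add_le_add_left (hthree x this) _
  have hNA : Disjoint A N := disjoint_right.2 fun x hx => ((memN x).1 hx).1
  have huniq : ∀ g h h', g ∉ A → g ≠ v → ¬ G.Adj v g → h ∉ A → h' ∉ A → G.Adj g h →
      G.Adj g h' → h = h' := by
    intro g h h' hg hgv hvg hh hh' hgh hgh'
    have := hadj v g hv hg hgv.symm hvg
    exact card_le_one.1 (show #{x | x ∉ A ∧ G.Adj g x} ≤ 1 by omega) _ (by simp [*]) _
      (by simp [*])
  have h5 := choose_add_five #A p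
  have ha := two_mul_choose_succ_le #A p
  have hb := two_mul_choose_succ_le (#A + 1) p
  have hc := two_mul_choose_succ_le (#A + 2) p
  have hd : (#A).choose p ≤ (#A + 1).choose p := Nat.choose_le_succ _ p
  by_cases hfar : ∃ f g, f ∉ A ∧ f ≠ v ∧ ¬ G.Adj v f ∧ g ∉ A ∧ g ≠ v ∧ ¬ G.Adj v g ∧ G.Adj f g
  · obtain ⟨f, g, hf, hfv, hvf, hg, hgv, hvg, hfg⟩ := hfar
    by_cases hall : ∀ x y, x ∉ A → x ≠ v → ¬ G.Adj v x → y ∉ A → y ≠ v → ¬ G.Adj v y →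
        G.Adj x y → x = f ∨ y = f
    · have := cliqueCount_add_le_of_cover (G := G) p (#A + 3) (#A + 1) A N {f} hNA
        (by simp [hf, hN, hvf]) (by
          intro x y hx hy hxy
          simp only [mem_union, memN, mem_singleton]
          by_cases hxv : x = v
          · subst hxv; tauto
          by_cases hyv : y = v
          · subst hyv; have := hxy.symm; tauto
          have := hall x y hx hxv
          tauto) hNd (by
          intro x hx
          rw [mem_singleton] at hx
          subst hx
          have := hadj v x hv hf hfv.symm hvf
          rw [hdeg x hf]
          omega)
      rw [hv3, card_singleton] at this
      nlinarith
    · push Not at hall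
      obtain ⟨f', g', hf', hfv', hvf', hg', hgv', hvg', hfg', hff', hgf'⟩ := hall
      have hgg : g ≠ f' := by
        rintro rfl
        exact hgf' (huniq g g' f hg hgv hvg hg' hf hfg' hfg.symm)
      have hgg' : g ≠ g' := by
        rintro rfl
        exact hff' (huniq g f' f hg hgv hvg hf' hf hfg'.symm hfg.symm)
      have hn₁ := hfg.ne
      have hn₂ := hfg'.ne
      have key : ∀ x y, x ∉ A → y ∉ A → G.Adj x y →
          x ∈ ({v, f, f'} : Finset V) ∨ y ∈ ({v, f, f'} : Finset V) := by
        intro x y hx hy hxy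
        by_contra! hcon
        simp only [mem_insert, mem_singleton, not_or] at hcon
        obtain ⟨⟨hxv, hxf, hxf'⟩, hyv, hyf, hyf'⟩ := hcon
        have hgu : ∀ y, y ∉ A → G.Adj g y → y = f := fun y hy hgy =>
          huniq g y f hg hgv hvg hy hf hgy hfg.symm
        have hgu' : ∀ y, y ∉ A → G.Adj g' y → y = f' := fun y hy hgy =>
          huniq g' y f' hg' hgv' hvg' hy hf' hgy hfg'.symm
        have hxg : x ≠ g := by rintro rfl; exact hyf (hgu y hy hxy)
        have hxg' : x ≠ g' := by rintro rfl; exact hyf' (hgu' y hy hxy)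
        have hyg : y ≠ g := by rintro rfl; exact hxf (hgu x hx hxy.symm)
        have hyg' : y ≠ g' := by rintro rfl; exact hxf' (hgu' x hx hxy.symm)
        have hn₃ := hxy.ne
        have near : ∀ x y, x ∉ A → y ∉ A → G.Adj x y → x ≠ v → y ≠ v → x ≠ f → x ≠ f' → x ≠ g →
            x ≠ g' → y ≠ f → y ≠ f' → y ≠ g → y ≠ g' → G.Adj v x → False := by
          intro x y hx hy hxy _ _ _ _ _ _ _ _ _ _ hvx
          have hn₃ := hxy.ne
          obtain ⟨o, ho, hoxy⟩ := exists_mem_notMem_of_card_lt_card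
            (show #({x, y} : Finset V) < #N by
              have := card_le_two (a := x) (b := y)
              omega)
          simp only [mem_insert, mem_singleton, not_or] at hoxy
          obtain ⟨hoA, hvo⟩ := (memN o).1 ho
          have hov := hvo.ne'
          have hof : o ≠ f := by rintro rfl; exact hvf hvo
          have hof' : o ≠ f' := by rintro rfl; exact hvf' hvo
          have hog : o ≠ g := by rintro rfl; exact hvg hvo
          have hog' : o ≠ g' := by rintro rfl; exact hvg' hvo
          have := hl [y, x, v, o, f, g, f', g'] (by
            simp only [List.nodup_cons, List.mem_cons, List.not_mem_nil, or_false, not_or,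
              not_false_eq_true, List.nodup_nil, and_true]
            grind) (by
            simp only [List.mem_cons, List.not_mem_nil, or_false]
            rintro z (rfl | rfl | rfl | rfl | rfl | rfl | rfl | rfl) <;> assumption)
          simp only [adjCount_cons_cons, adjCount_singleton, adjInd_of_adj hxy.symm,
            adjInd_of_adj hvx.symm, adjInd_of_adj hvo, adjInd_of_adj hfg,
            adjInd_of_adj hfg'] at this
          omega
        by_cases hvx : G.Adj v x
        · exact near x y hx hy hxy hxv hyv hxf hxf' hxg hxg' hyf hyf' hyg hyg' hvx
        by_cases hvy : G.Adj v y
        · exact near y x hy hx hxy.symm hyv hxv hyf hyf' hyg hyg' hxf hxf' hxg hxg' hvy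
        obtain ⟨o, o', o'', hoo, -, -, hNo⟩ := card_eq_three.1 hv3
        have ho := (memN o).1 (by rw [hNo]; simp)
        have ho' := (memN o').1 (by rw [hNo]; simp)
        have hne : ∀ z z', G.Adj v z → ¬ G.Adj v z' → z ≠ z' := by
          rintro z _ h h' rfl
          exact h' h
        have hov := ho.2.ne'
        have hov' := ho'.2.ne'
        have := hl [o, v, o', f, g, f', g', x, y] (by
          simp only [List.nodup_cons, List.mem_cons, List.not_mem_nil, or_false, not_or,
            not_false_eq_true, List.nodup_nil, and_true]
          grind) (by
          simp only [List.mem_cons, List.not_mem_nil, or_false]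
          rintro z (rfl | rfl | rfl | rfl | rfl | rfl | rfl | rfl | rfl) <;> tauto)
        simp only [adjCount_cons_cons, adjCount_singleton, adjInd_of_adj hxy,
          adjInd_of_adj ho.2.symm, adjInd_of_adj ho'.2, adjInd_of_adj hfg,
          adjInd_of_adj hfg'] at this
        omega
      have := cliqueCount_add_le_of_cover (G := G) p (#A + 3) 0 A {v, f, f'} ∅
        (by simp [hf, hf', hv]) (by simp) (by simpa using key) (by
          intro x hx
          have hxA : x ∉ A := by
            simp only [mem_insert, mem_singleton] at hx
            rcases hx with rfl | rfl | rfl <;> assumption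
          rw [hdeg x hxA]
          exact Nat.add_le_add_left (hthree x hxA) _) (by simp)
      rw [card_eq_three.2 ⟨v, f, f', hfv.symm, hfv'.symm, hff'.symm, rfl⟩, card_empty] at this
      nlinarith
  · have := cliqueCount_add_le_of_cover (G := G) p (#A + 3) 0 A N ∅ hNA (by simp) (by
      intro x y hx hy hxy
      simp only [union_empty, memN]
      by_contra! hcon
      refine hfar ⟨x, y, hx, ?_, hcon.1 hx, hy, ?_, hcon.2 hy, hxy⟩
      · rintro rfl
        exact hcon.2 hy hxy
      · rintro rfl
        exact hcon.1 hx hxy.symm) hNd (by simp)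
    rw [hv3, card_empty] at this
    nlinarith

/-- Clique count when there are `t - 2` universal vertices. -/
lemma cliqueCount_add_le_of_card_universal {p : ℕ} (A : Finset V)
    (hA : ∀ v, v ∈ A ↔ ∀ w, w ≠ v → G.Adj v w)
    (hG : Maximal (PairBounded (2 * #A + 5)) G) (hn : 3 * #A + 5 < Fintype.card V)
    (hdeg : ∀ v ∉ A, #{x | G.Adj v x} + #A < 2 * #A + 5) :
    cliqueCount G (p + 1) univ + (#A + 5) * (#A).choose p ≤
      (#A + 5).choose (p + 1) + Fintype.card V * (#A).choose p := by
  have hsplit : ∀ v ∉ A, #{x | G.Adj v x} = #A + #{x | x ∉ A ∧ G.Adj v x} := by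
    intro v hv
    rw [← card_union_of_disjoint (disjoint_left.2 fun x hx hx' => (mem_filter.1 hx').2.1 hx)]
    congr 1
    ext x
    have : x ∈ A → G.Adj v x := fun hx =>
      ((hA x).1 hx v (by rintro rfl; exact hv hx)).symm
    simp only [mem_filter, mem_univ, true_and, mem_union]
    tauto
  have hl : ∀ l : List V, l.Nodup → (∀ x ∈ l, x ∉ A) → adjCount G l ≤ 4 := fun l hl hlA => by
    have := adjCount_add_two_mul_card_lt hG.1 A (fun v hv => (hA v).1 hv) (by omega) l hl hlA
    omega
  have hadj : ∀ u v, u ∉ A → v ∉ A → u ≠ v → ¬ G.Adj u v →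
      #{x | x ∉ A ∧ G.Adj u x} + #{x | x ∉ A ∧ G.Adj v x} ≤ 4 := fun u v hu hv huv h => by
    have := degree_add_degree_lt hG huv h
    rw [hsplit u hu, hsplit v hv] at this
    omega
  by_cases h4 : ∃ v ∉ A, 4 ≤ #{x | x ∉ A ∧ G.Adj v x}
  · obtain ⟨v, hv, hv4⟩ := h4
    have hv4' : #{x | x ∉ A ∧ G.Adj v x} = 4 := by
      have := hdeg v hv
      rw [hsplit v hv] at this
      omega
    set N : Finset V := {x | x ∉ A ∧ G.Adj v x} with hN
    have hN4 : #{x | x ∉ A ∧ G.Adj v x} = 4 := hv4'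
    have hU : #(insert v (A ∪ N)) = #A + 5 := by
      rw [card_insert_of_notMem (by simp [hv, hN]), card_union_of_disjoint
        (disjoint_left.2 fun x hx hx' => (mem_filter.1 hx').2.1 hx), hv4']
    have h₁ := cliqueCount_le_of_subset (G := G) (p := p) (m := #A)
      (subset_univ (insert v (A ∪ N))) (by
        intro w _ hw
        simp only [hN, mem_insert, mem_union, mem_filter, mem_univ, true_and, not_or] at hw
        have hwv := hadj v w hv hw.2.1 (Ne.symm hw.1) (fun h => hw.2.2 ⟨hw.2.1, h⟩)
        rw [hsplit w hw.2.1]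
        omega)
    have h₂ := cliqueCount_le_choose (G := G) (p + 1) (insert v (A ∪ N))
    rw [hU] at h₁ h₂
    rw [card_univ] at h₁
    obtain ⟨e, he⟩ := Nat.exists_eq_add_of_le (show #A + 5 ≤ Fintype.card V by omega)
    rw [he, Nat.add_sub_cancel_left] at h₁
    rw [he]
    nlinarith
  push Not at h4
  by_cases h3 : ∃ v ∉ A, 3 ≤ #{x | x ∉ A ∧ G.Adj v x}
  · obtain ⟨v, hv, hv3⟩ := h3
    exact cliqueCount_add_le_of_degree_eq_three A hsplit hadj hl
      (fun v hv => Nat.le_of_lt_succ (h4 v hv)) hv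
      (le_antisymm (Nat.le_of_lt_succ (h4 v hv)) hv3)
  push Not at h3
  have hfilt : ∀ v, #{x ∈ Aᶜ | G.Adj v x} = #{x | x ∉ A ∧ G.Adj v x} := fun v => by
    congr 1
    ext
    simp
  obtain ⟨T, hT, hTc, hcov⟩ := exists_cover_of_degree_le_two (G := G) Aᶜ (by
    intro v hv
    rw [hfilt]
    exact Nat.le_of_lt_succ (h3 v (mem_compl.1 hv))) 4 (by simpa using hl)
  have := cliqueCount_add_le_of_cover (G := G) p (#A + 2) 0 A T ∅
    (by rwa [← subset_compl_iff_disjoint_left]) (by simp) (by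
      simpa using fun u v hu hv => hcov u (by simpa using hu) v (by simpa using hv)) (by
      intro v hv
      have := mem_compl.1 (hT hv)
      have := h3 v this
      rw [hsplit v ‹_›]
      omega) (by simp)
  have h5 := choose_add_five #A p
  have ha := two_mul_choose_succ_le #A p
  have hb := two_mul_choose_succ_le (#A + 1) p
  have hc : (#A + 2).choose p ≤ (#A + 4).choose p := Nat.choose_mono _ (by omega)
  have hd : (#A).choose p ≤ (#A + 2).choose p := Nat.choose_mono _ (by omega)
  have he : (4 - #T) * (#A).choose p ≤ (4 - #T) * (#A + 2).choose p := Nat.mul_le_mul_left _ hd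
  obtain ⟨s, hs⟩ := Nat.exists_eq_add_of_le hTc
  have hs' : 4 - #T = s := by omega
  rw [hs'] at he
  rw [card_empty] at this
  have e1 : #T * (#A + 2).choose p + s * (#A + 2).choose p = 4 * (#A + 2).choose p := by
    rw [hs]; ring
  have e2 : #T * (#A).choose p + s * (#A).choose p = 4 * (#A).choose p := by
    rw [hs]; ring
  nlinarith

/-- Clique count when there are fewer than `t - 2` universal vertices. -/
lemma cliqueCount_le_of_card_universal_lt {t p d : ℕ} (hG : Maximal (PairBounded (2 * t + 1)) G)
    (hn : (2 * t + 1) ^ 5 < Fintype.card V) (hd : ∀ v, d ≤ #{x | G.Adj v x})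
    (hp : 1 ≤ p) (hpt : p + 2 ≤ t) (A : Finset V)
    (hA : ∀ v, v ∈ A ↔ ∀ w, w ≠ v → G.Adj v w) (hAt : #A + 3 ≤ t) :
    (cliqueCount G (p + 1) univ : ℤ) ≤
      max (hr (p + 1) (Fintype.card V) (2 * t + 1) d)
        (hr (p + 1) (Fintype.card V) (2 * t + 1) (t - 2)) := by
  have hA' : ∀ v, v ∉ A → ∃ w, w ≠ v ∧ ¬ G.Adj v w := fun v hv => by
    rw [hA] at hv
    push Not at hv
    exact hv
  have hn' : 2 * t + 1 < Fintype.card V := (Nat.le_self_pow (by simp) _).trans_lt hn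
  set S : Finset V := {x | x ∉ A ∧ ∃ w, w ∉ A ∧ G.Adj x w} with hS
  have hScard := card_lt_of_pairBounded hG A S hA'
    (disjoint_left.2 fun x hx => (mem_filter.1 hx).2.1) (fun x hx => (mem_filter.1 hx).2.2)
  have hW := card_union_le A S
  have hnbr : ∀ v ∉ A ∪ S, ∀ x, G.Adj v x → x ∈ A := by
    intro v hv x hvx
    simp only [hS, mem_union, mem_filter, mem_univ, true_and, not_or] at hv
    by_contra hx
    exact hv.2 ⟨hv.1, x, hx, hvx⟩
  obtain ⟨K, -, hcore, hout, hcount⟩ := exists_core G p (t + 1) (A ∪ S)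
  rcases K.eq_empty_or_nonempty with rfl | hK
  · obtain ⟨s, rfl⟩ := Nat.exists_eq_add_of_le' (show 3 ≤ t by omega)
    obtain ⟨j, rfl⟩ := Nat.exists_eq_add_of_le' hp
    rw [show 2 * (s + 3) + 1 = 2 * s + 7 by ring] at hScard
    have h₁ := cliqueCount_le_of_subset (G := G) (p := j + 1) (m := #A) (subset_univ (A ∪ S))
      (fun v _ hv => card_le_card fun x hx => hnbr v hv x (mem_filter.1 hx).2)
    have h₂ := cliqueCount_le_choose (G := G) (j + 1 + 1) ∅
    have h₃ := mul_choose_add_le (s := s) (j := j) (a := #A) (X := #(A ∪ S)) (by omega)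
      (by omega) (by omega) hn
    rw [card_empty, Nat.choose_zero_succ] at h₂
    rw [card_empty, Nat.sub_zero] at hcount
    have h₄ : (Fintype.card V - #(A ∪ S)) * (#A).choose (j + 1) ≤
        Fintype.card V * (#A).choose (j + 1) := Nat.mul_le_mul_right _ (Nat.sub_le _ _)
    rw [card_univ] at h₁
    have h₅ : cliqueCount G (j + 1 + 1) univ + (s + 6) * (s + 1).choose (j + 1) ≤
        Fintype.card V * (s + 1).choose (j + 1) := by
      have : s + 3 + 1 = s + 4 := rfl
      rw [this] at hcount
      omega
    refine le_trans ?_ (le_max_right _ _)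
    have h₆ : ((cliqueCount G (j + 1 + 1) univ : ℕ) : ℤ) + (s + 6) * (s + 1).choose (j + 1) ≤
        Fintype.card V * (s + 1).choose (j + 1) := by exact_mod_cast h₅
    rw [hr, Nat.add_sub_cancel, show s + 3 - 2 = s + 1 by omega]
    push_cast
    have h₇ : (0 : ℤ) ≤ ((2 * (s + 3) + 1 - (s + 1)).choose (j + 1 + 1) : ℕ) :=
      Int.natCast_nonneg _
    linarith
  · refine cliqueCount_le_of_core hG hn' hd hp K hK hcore fun v hv => ?_
    by_cases hvW : v ∈ A ∪ S
    · exact hout v hvW hv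
    · have : #{x ∈ K | G.Adj v x} ≤ #A :=
        card_le_card fun x hx => hnbr v hvW x (mem_filter.1 hx).2
      omega

/-- A maximal graph with many cliques has at least `t - 1` universal vertices. -/
lemma lt_card_universal {t p d : ℕ} (hG : Maximal (PairBounded (2 * t + 1)) G)
    (hn : (2 * t + 1) ^ 5 < Fintype.card V) (hd : ∀ v, d ≤ #{x | G.Adj v x})
    (hp : 1 ≤ p) (hpt : p + 2 ≤ t) (A : Finset V)
    (hA : ∀ v, v ∈ A ↔ ∀ w, w ≠ v → G.Adj v w)
    (hcount : max (hr (p + 1) (Fintype.card V) (2 * t + 1) d)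
        (hr (p + 1) (Fintype.card V) (2 * t + 1) (t - 2)) < (cliqueCount G (p + 1) univ : ℤ)) :
    t < #A + 2 := by
  by_contra! hcon
  rcases hcon.lt_or_eq with h | h
  · exact hcount.not_ge (cliqueCount_le_of_card_universal_lt hG hn hd hp hpt A hA h)
  · subst h
    have hbig : #A + 2 * (2 * (#A + 2) + 1) * (2 * (#A + 2) + 1) + 1 < Fintype.card V := by
      refine lt_of_le_of_lt ?_ hn
      generalize #A = a
      nlinarith [Nat.zero_le (a ^ 2), Nat.zero_le (a ^ 3), Nat.zero_le (a ^ 4),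
        Nat.zero_le (a ^ 5)]
    have h₁ := cliqueCount_add_le_of_card_universal (p := p) A hA hG (by nlinarith)
      (fun v hv => by
        have := degree_add_card_lt hG A hA hbig hv
        omega)
    refine hcount.not_ge ((le_max_right _ _).trans' ?_)
    have h₂ : ((cliqueCount G (p + 1) univ : ℕ) : ℤ) + (#A + 5) * (#A).choose p ≤
        (#A + 5).choose (p + 1) + Fintype.card V * (#A).choose p := by exact_mod_cast h₁
    rw [hr, Nat.add_sub_cancel, Nat.add_sub_cancel,
      show 2 * (#A + 2) + 1 - #A = #A + 5 by omega]
    push_cast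
    linarith

end Counting

open Classical in
/-- The dichotomy for maximal graphs. -/
lemma isoSubgraph_of_maximal {V : Type*} [Fintype V] {G : SimpleGraph V} {t p d : ℕ}
    (hG : Maximal (PairBounded (2 * t + 1)) G)
    (hn : (2 * t + 1) ^ 5 < Fintype.card V) (hd : ∀ v, d ≤ degN G v)
    (hp : 1 ≤ p) (hpt : p + 2 ≤ t)
    (hcount : max (hr (p + 1) (Fintype.card V) (2 * t + 1) d)
        (hr (p + 1) (Fintype.card V) (2 * t + 1) (t - 2)) < (Nr (p + 1) G : ℤ)) :
    IsoSubgraph G (HGraph (Fintype.card V) (2 * t + 1) t) ∨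
      IsoSubgraph G (HGraph (Fintype.card V) (2 * t + 1) (t - 1)) ∨
      IsoSubgraph G (HplusGraph (Fintype.card V) (2 * t) (t - 1)) := by
  have hd' : ∀ v, d ≤ ({x | G.Adj v x} : Finset V).card := fun v => by
    have h := hd v
    rw [degN, Set.ncard_eq_toFinset_card'] at h
    convert h
    ext
    simp
  rw [Nr_eq_cliqueCount] at hcount
  set A : Finset V := {v | ∀ w, w ≠ v → G.Adj v w} with hAdef
  have hA : ∀ v, v ∈ A ↔ ∀ w, w ≠ v → G.Adj v w := by simp [hAdef]
  have hlow := lt_card_universal hG hn hd' hp hpt A hA hcount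
  have hbig : 2 * (2 * t + 1) < Fintype.card V := by
    refine lt_of_le_of_lt ?_ hn
    have : 2 * (2 * t + 1) ≤ (2 * t + 1) ^ 4 * (2 * t + 1) :=
      Nat.mul_le_mul_right _ ((by omega : 2 ≤ 2 * t + 1).trans (Nat.le_self_pow (by simp) _))
    rwa [← pow_succ] at this
  have hup : A.card ≤ t := by
    by_contra! h
    obtain ⟨B, hB, hBt⟩ := Finset.exists_subset_card_eq (Nat.succ_le_of_lt h)
    have := adjCount_add_two_mul_card_lt hG.1 B (fun v hv => (hA v).1 (hB hv)) (by omega) []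
      (by simp) (by simp)
    omega
  have hlist := adjCount_add_two_mul_card_lt hG.1 A (fun v hv => (hA v).1 hv) (by omega)
  rcases hup.lt_or_eq with h | h
  · exact isoSubgraph_of_adjCount_le_two rfl A (by omega) fun l hl hlA => by
      have := hlist l hl hlA
      omega
  · refine Or.inl (isoSubgraph_HGraph_of_cover rfl A h.le fun u v huv => ?_)
    by_contra! hcon
    have := hlist [u, v] (by simpa using huv.ne) (by simpa using hcon)
    rw [adjCount_cons_cons, adjInd_of_adj huv] at this
    omega

/-- stability, odd case. Let `k` be odd, and let `G` be an `𝓛ₖ`-free graph on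
`n > k^5` vertices with minimum degree at least `d`. If `2 ≤ r ≤ ⌊(k-3)/2⌋` and
`Nᵣ(G) > max { hᵣ(n,k,d), hᵣ(n,k,⌊(k-5)/2⌋) }`, then `G` is isomorphic to a subgraph of
`H(n,k,⌊(k-1)/2⌋)`, of `H(n,k,⌊(k-3)/2⌋)`, or of `H⁺(n,k-1,⌊(k-3)/2⌋)`. -/
theorem statement4 {V : Type*} [Fintype V] (G : SimpleGraph V) (n k d r : ℕ)
    (hcard : Fintype.card V = n) (hk : 0 < k) (hodd : Odd k)
    (hfree : LinearForestFree k G) (hmindeg : ∀ v, d ≤ degN G v)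
    (hn : k ^ 5 < n) (hr2 : 2 ≤ r) (hrk : r ≤ (k - 3) / 2)
    (hNr : max (hr r n k d) (hr r n k ((k - 5) / 2)) < (Nr r G : ℤ)) :
    IsoSubgraph G (HGraph n k ((k - 1) / 2)) ∨
      IsoSubgraph G (HGraph n k ((k - 3) / 2)) ∨
      IsoSubgraph G (HplusGraph n (k - 1) ((k - 3) / 2)) := by
  classical
  subst hcard
  obtain ⟨t, rfl⟩ := hodd
  obtain ⟨p, rfl⟩ := Nat.exists_eq_add_of_le' (show 1 ≤ r by omega)
  rw [show (2 * t + 1 - 5) / 2 = t - 2 by omega] at hNr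
  rw [show (2 * t + 1 - 1) / 2 = t by omega, show (2 * t + 1 - 3) / 2 = t - 1 by omega,
    Nat.add_sub_cancel]
  obtain ⟨M, hGM, hM⟩ :=
    Set.Finite.exists_le_maximal (Set.toFinite {M : SimpleGraph V | PairBounded (2 * t + 1) M})
      (PairBounded.of_linearForestFree hfree)
  have hiso : ∀ H : SimpleGraph (Fin (Fintype.card V)), IsoSubgraph M H → IsoSubgraph G H :=
    fun H ⟨f, hf⟩ => ⟨f, fun u v huv => hf u v (hGM huv)⟩
  have hdeg : ∀ v, d ≤ degN M v := fun v =>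
    (hmindeg v).trans (Set.ncard_le_ncard (fun x hx => hGM hx) (Set.toFinite _))
  have hcount : Nr (p + 1) G ≤ Nr (p + 1) M :=
    Set.ncard_le_ncard (fun s hs => hs.mono hGM) (Set.toFinite _)
  exact (isoSubgraph_of_maximal hM hn hdeg (by omega) (by omega)
    (hNr.trans_le (by exact_mod_cast hcount))).imp (hiso _) (Or.imp (hiso _) (hiso _))
end
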